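/- arXiv:1110.5448 — 5 statements merged into one kernel-verified Lean document; each statement's English description precedes it below -/
import Mathlib

section
/- Let (Ω, ℬ) be a measurable space, 𝒫 a nonempty family of probability measures on (Ω, ℬ), p ≥ 1, and ‖X‖_p := (sup_{P∈𝒫} ∫_Ω |X|^p dP)^{1/p}. If (X_n)_{n≥1} is a sequence of measurable real-valued functions with ‖X_n‖_p < ∞ for every n and which is Cauchy for ‖·‖_p (i.e. ‖X_n − X_m‖_p → 0 as n, m → ∞), then there exists a measurable function X : Ω → ℝ with ‖X‖_p < ∞ such that ‖X_n − X‖_p → 0 as n → ∞. In other words, 𝕃^p := ℒ^p/𝒩 is a Banach space under ‖·‖_p. -/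
open MeasureTheory Filter Set
open scoped ENNReal Topology

/-- The uniform `L^p` size over a family of measures, raised to the power `1 / p`, is the supremum
of the `L^p` seminorms. -/
theorem iSup_lintegral_rpow_eq_iSup_eLpNorm {Ω : Type*} [MeasurableSpace Ω]
    (Ps : Set (Measure Ω)) {p : ℝ} (hp : 0 < p) (X : Ω → ℝ) :
    (⨆ P ∈ Ps, ∫⁻ ω, ENNReal.ofReal (|X ω| ^ p) ∂P) ^ (1 / p)
      = ⨆ P ∈ Ps, eLpNorm X (ENNReal.ofReal p) P := by
  have hinv : 0 < 1 / p := by positivity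
  have h := (ENNReal.orderIsoRpow (1 / p) hinv).map_iSup₂
    (fun P (_ : P ∈ Ps) => ∫⁻ ω, ENNReal.ofReal (|X ω| ^ p) ∂P)
  simp only [ENNReal.orderIsoRpow_apply] at h
  rw [h]
  refine biSup_congr fun P _ => ?_
  rw [eLpNorm_eq_lintegral_rpow_enorm_toReal (by simpa using hp) ENNReal.ofReal_ne_top,
    ENNReal.toReal_ofReal hp.le]
  congr 2 with ω
  rw [← ENNReal.ofReal_rpow_of_nonneg (abs_nonneg _) hp.le, Real.enorm_eq_ofReal_abs]

/-- A sequence which is summably Cauchy in `L^q`, uniformly over a family of measures, has a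
measurable function to which it converges almost everywhere for each member of the family. -/
theorem exists_measurable_forall_ae_tendsto {Ω : Type*} [MeasurableSpace Ω]
    {Ps : Set (Measure Ω)} {q : ℝ≥0∞} (hq : 1 ≤ q) {f : ℕ → Ω → ℝ}
    (hf : ∀ n, Measurable (f n)) {B : ℕ → ℝ≥0∞} (hB : ∑' i, B i ≠ ∞)
    (hcau : ∀ P ∈ Ps, ∀ N n m : ℕ, N ≤ n → N ≤ m → eLpNorm (f n - f m) q P < B N) :
    ∃ Y : Ω → ℝ, Measurable Y ∧
      ∀ P ∈ Ps, ∀ᵐ ω ∂P, Tendsto (fun n => f n ω) atTop (𝓝 (Y ω)) := by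
  refine ⟨fun ω => limsup (fun n => f n ω) atTop, .limsup hf, fun P hP => ?_⟩
  filter_upwards [Lp.ae_tendsto_of_cauchy_eLpNorm
    (fun n => (hf n).aestronglyMeasurable) hq hB (hcau P hP)] with ω ⟨l, hl⟩
  rwa [hl.limsup_eq]

/-- Completeness of `𝕃^p = ℒ^p/𝒩` for `p ≥ 1` under the norm
`‖X‖_p = (sup_{P ∈ Ps} ∫ |X|^p dP)^{1/p}`: every Cauchy sequence of measurable functions
with finite `p`-norm converges in `‖·‖_p` to a measurable function of finite `p`-norm. -/
theorem stmt_4 {Ω : Type*} [MeasurableSpace Ω] (Ps : Set (Measure Ω))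
    (hPs : Ps.Nonempty) (hprob : ∀ P ∈ Ps, IsProbabilityMeasure P)
    (p : ℝ) (hp : 1 ≤ p)
    (norm_p : (Ω → ℝ) → ℝ≥0∞)
    (hnorm : ∀ X : Ω → ℝ, norm_p X
      = (⨆ P ∈ Ps, ∫⁻ ω, ENNReal.ofReal (|X ω| ^ p) ∂P) ^ (1 / p))
    (X : ℕ → Ω → ℝ) (hXmeas : ∀ n, Measurable (X n))
    (hXfin : ∀ n, norm_p (X n) < ⊤)
    (hcauchy : ∀ ε : ℝ≥0∞, 0 < ε → ∃ N : ℕ, ∀ n ≥ N, ∀ m ≥ N,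
      norm_p (X n - X m) < ε) :
    ∃ Y : Ω → ℝ, Measurable Y ∧ norm_p Y < ⊤ ∧
      Tendsto (fun n => norm_p (X n - Y)) atTop (𝓝 0) := by
  have hq : 1 ≤ ENNReal.ofReal p := by simpa using hp
  have hsup (Z : Ω → ℝ) : norm_p Z = ⨆ P ∈ Ps, eLpNorm Z (ENNReal.ofReal p) P := by
    rw [hnorm, iSup_lintegral_rpow_eq_iSup_eLpNorm Ps (by linarith)]
  have hle (Z : Ω → ℝ) {P : Measure Ω} (hP : P ∈ Ps) :
      eLpNorm Z (ENNReal.ofReal p) P ≤ norm_p Z :=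
    hsup Z ▸ le_iSup₂ (f := fun P (_ : P ∈ Ps) => eLpNorm Z (ENNReal.ofReal p) P) P hP
  obtain ⟨B, hBpos, hBsum⟩ := ENNReal.exists_pos_sum_of_countable' one_ne_zero ℕ
  choose K hK using fun k => hcauchy (B k) (hBpos k)
  obtain ⟨φ, hφ, hφK⟩ : ∃ φ : ℕ → ℕ, StrictMono φ ∧ ∀ k, K k ≤ φ k :=
    extraction_forall_of_eventually' fun k => ⟨K k, fun _ h => h⟩
  obtain ⟨Y, hY, hlim⟩ := exists_measurable_forall_ae_tendsto (Ps := Ps) hq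
    (fun k => hXmeas (φ k)) (hBsum.trans ENNReal.one_lt_top).ne fun P hP N n m hn hm =>
      (hle _ hP).trans_lt <| hK N _ ((hφK N).trans (hφ.monotone hn))
        _ ((hφK N).trans (hφ.monotone hm))
  have hconv (ε : ℝ≥0∞) (hε : 0 < ε) : ∃ N, ∀ n ≥ N, norm_p (X n - Y) ≤ ε := by
    obtain ⟨N, hN⟩ := hcauchy ε hε
    refine ⟨N, fun n hn => ?_⟩
    rw [hsup]
    refine iSup₂_le fun P hP => ?_
    refine (Lp.eLpNorm_lim_le_liminf_eLpNorm (f := fun k => X n - X (φ k))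
      (fun k => ((hXmeas n).sub (hXmeas (φ k))).aestronglyMeasurable) (X n - Y) ?_).trans ?_
    · filter_upwards [hlim P hP] with ω hω using hω.const_sub _
    · refine liminf_le_of_frequently_le' (Eventually.frequently ?_)
      filter_upwards [eventually_ge_atTop N] with k hk
      exact (hle _ hP).trans (hN n hn _ (hk.trans (hφ.id_le k))).le
  refine ⟨Y, hY, ?_, ?_⟩
  · obtain ⟨N, hN⟩ := hconv 1 one_pos
    refine lt_of_le_of_lt ?_ (ENNReal.add_lt_top.2 ⟨hXfin N, ENNReal.one_lt_top⟩)
    rw [hsup Y]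
    refine iSup₂_le fun P hP => ?_
    calc eLpNorm Y (ENNReal.ofReal p) P
        = eLpNorm (X N - (X N - Y)) (ENNReal.ofReal p) P := by rw [sub_sub_cancel]
      _ ≤ eLpNorm (X N) (ENNReal.ofReal p) P + eLpNorm (X N - Y) (ENNReal.ofReal p) P :=
          eLpNorm_sub_le (hXmeas N).aestronglyMeasurable
            ((hXmeas N).sub hY).aestronglyMeasurable hq
      _ ≤ norm_p (X N) + 1 := add_le_add (hle _ hP) ((hle _ hP).trans (hN N le_rfl))
  · exact ENNReal.tendsto_atTop_zero.2 hconv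
end

section
/- Let (Ω, ℬ) be a measurable space, 𝒫 a nonempty family of probability measures on (Ω, ℬ), and 0 < p < 1. Define d(X, Y) := sup_{P∈𝒫} ∫_Ω |X − Y|^p dP for measurable X, Y. Then d satisfies the triangle inequality d(X, Z) ≤ d(X, Y) + d(Y, Z), and ℒ^p := {X measurable : d(X, 0) < ∞} is complete for d: every sequence (X_n) in ℒ^p with d(X_n, X_m) → 0 as n, m → ∞ admits a measurable X ∈ ℒ^p with d(X_n, X) → 0. In other words, for 0 < p < 1, 𝕃^p := ℒ^p/𝒩 is a complete metric space under the distance d. -/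
open MeasureTheory Filter Set
open scoped ENNReal Topology

/-- A sequence whose consecutive distances have summable `p`-th powers, `0 < p ≤ 1`, is Cauchy. -/
theorem cauchySeq_of_tsum_edist_rpow_ne_top {α : Type*} [PseudoEMetricSpace α] {p : ℝ}
    (hp0 : 0 < p) (hp1 : p ≤ 1) {f : ℕ → α}
    (hf : ∑' n, edist (f n) (f (n + 1)) ^ p ≠ ⊤) : CauchySeq f := by
  set S := ∑' n, edist (f n) (f (n + 1)) ^ p
  have hq : 0 ≤ 1 / p - 1 := by
    rw [sub_nonneg, le_div_iff₀ hp0]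
    linarith
  refine cauchySeq_of_edist_le_of_tsum_ne_top
    (fun n => edist (f n) (f (n + 1)) ^ p * S ^ (1 / p - 1)) (fun n => ?_) ?_
  · calc edist (f n) (f (n + 1))
        = (edist (f n) (f (n + 1)) ^ p) ^ (1 + (1 / p - 1)) := by
          rw [← ENNReal.rpow_mul, add_sub_cancel, mul_one_div_cancel hp0.ne', ENNReal.rpow_one]
      _ = edist (f n) (f (n + 1)) ^ p * (edist (f n) (f (n + 1)) ^ p) ^ (1 / p - 1) := by
          rw [ENNReal.rpow_add_of_nonneg _ _ zero_le_one hq, ENNReal.rpow_one]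
      _ ≤ edist (f n) (f (n + 1)) ^ p * S ^ (1 / p - 1) := by
          gcongr
          exact ENNReal.le_tsum n
  · rw [ENNReal.tsum_mul_right]
    exact ENNReal.mul_ne_top hf (ENNReal.rpow_ne_top_of_nonneg hq hf)

/-- If the integrals of the `p`-th powers of consecutive distances are summable, then the sequence
converges almost everywhere to its pointwise `limUnder`. -/
theorem ae_tendsto_limUnder_of_tsum_lintegral_edist_rpow_ne_top {Ω : Type*} [MeasurableSpace Ω]
    {P : Measure Ω} {p : ℝ} (hp0 : 0 < p) (hp1 : p ≤ 1) {f : ℕ → Ω → ℝ}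
    (hf : ∀ n, Measurable (f n))
    (hsum : ∑' n, ∫⁻ ω, edist (f n ω) (f (n + 1) ω) ^ p ∂P ≠ ⊤) :
    ∀ᵐ ω ∂P, Tendsto (fun n => f n ω) atTop (𝓝 (limUnder atTop fun n => f n ω)) := by
  have hmeas : ∀ n, Measurable fun ω => edist (f n ω) (f (n + 1) ω) ^ p := fun n =>
    ((hf n).edist (hf (n + 1))).pow_const p
  rw [← lintegral_tsum fun n => (hmeas n).aemeasurable] at hsum
  filter_upwards [ae_lt_top (Measurable.tsum hmeas) hsum] with ω hω
  exact (cauchySeq_of_tsum_edist_rpow_ne_top hp0 hp1 hω.ne).tendsto_limUnder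

/-- Fatou's lemma for `p`-th powers of distances. -/
theorem lintegral_edist_rpow_le_of_ae_tendsto {Ω : Type*} [MeasurableSpace Ω]
    {P : Measure Ω} {p : ℝ} {f : ℕ → Ω → ℝ} {g h : Ω → ℝ}
    (hf : ∀ n, Measurable (f n)) (hg : Measurable g)
    (hlim : ∀ᵐ ω ∂P, Tendsto (fun n => f n ω) atTop (𝓝 (h ω))) {C : ℝ≥0∞}
    (hC : ∀ᶠ n in atTop, ∫⁻ ω, edist (g ω) (f n ω) ^ p ∂P ≤ C) :
    ∫⁻ ω, edist (g ω) (h ω) ^ p ∂P ≤ C := by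
  calc ∫⁻ ω, edist (g ω) (h ω) ^ p ∂P
      = ∫⁻ ω, liminf (fun n => edist (g ω) (f n ω) ^ p) atTop ∂P := by
        refine lintegral_congr_ae ?_
        filter_upwards [hlim] with ω hω
        exact ((ENNReal.continuous_rpow_const.tendsto _).comp
          (tendsto_const_nhds.edist hω)).liminf_eq.symm
    _ ≤ liminf (fun n => ∫⁻ ω, edist (g ω) (f n ω) ^ p ∂P) atTop :=
        lintegral_liminf_le fun n => (hg.edist (hf n)).pow_const p
    _ ≤ C := (liminf_le_liminf hC).trans_eq (liminf_const C)

/-- For `0 < p < 1`, the distance `d(X,Y) := sup_{P ∈ Ps} ∫ |X - Y|^p dP` satisfies the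
triangle inequality, and `ℒ^p` is complete for `d`: every `d`-Cauchy sequence of measurable
functions in `ℒ^p` converges in `d` to some measurable function in `ℒ^p`. Hence
`𝕃^p = ℒ^p/𝒩` is a complete metric space under `d`. -/
theorem stmt_5 {Ω : Type*} [MeasurableSpace Ω] (Ps : Set (Measure Ω))
    (hPs : Ps.Nonempty) (hprob : ∀ P ∈ Ps, IsProbabilityMeasure P)
    (p : ℝ) (hp0 : 0 < p) (hp1 : p < 1)
    (dist_p : (Ω → ℝ) → (Ω → ℝ) → ℝ≥0∞)
    (hdist : ∀ X Y : Ω → ℝ, dist_p X Y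
      = ⨆ P ∈ Ps, ∫⁻ ω, ENNReal.ofReal (|X ω - Y ω| ^ p) ∂P) :
    (∀ X Y Z : Ω → ℝ, Measurable X → Measurable Y → Measurable Z →
      dist_p X Z ≤ dist_p X Y + dist_p Y Z) ∧
    (∀ X : ℕ → Ω → ℝ, (∀ n, Measurable (X n)) → (∀ n, dist_p (X n) 0 < ⊤) →
      (∀ ε : ℝ≥0∞, 0 < ε → ∃ N : ℕ, ∀ n ≥ N, ∀ m ≥ N, dist_p (X n) (X m) < ε) →
      ∃ Y : Ω → ℝ, Measurable Y ∧ dist_p Y 0 < ⊤ ∧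
        Tendsto (fun n => dist_p (X n) Y) atTop (𝓝 0)) := by
  have hd : ∀ X Y : Ω → ℝ, dist_p X Y = ⨆ P ∈ Ps, ∫⁻ ω, edist (X ω) (Y ω) ^ p ∂P := by
    intro X Y
    simp only [hdist, edist_dist, Real.dist_eq]
    simp only [ENNReal.ofReal_rpow_of_nonneg (abs_nonneg _) hp0.le]
  have hle : ∀ P ∈ Ps, ∀ X Y : Ω → ℝ, ∫⁻ ω, edist (X ω) (Y ω) ^ p ∂P ≤ dist_p X Y := by
    intro P hP X Y
    rw [hd]
    exact le_iSup₂ (f := fun P (_ : P ∈ Ps) => ∫⁻ ω, edist (X ω) (Y ω) ^ p ∂P) P hP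
  have hcomm : ∀ X Y : Ω → ℝ, dist_p X Y = dist_p Y X := fun X Y => by
    simp only [hd, edist_comm]
  have htri : ∀ X Y Z : Ω → ℝ, Measurable X → Measurable Y → Measurable Z →
      dist_p X Z ≤ dist_p X Y + dist_p Y Z := by
    intro X Y Z hX hY hZ
    rw [hd X Z]
    refine iSup₂_le fun P hP => ?_
    calc ∫⁻ ω, edist (X ω) (Z ω) ^ p ∂P
        ≤ ∫⁻ ω, edist (X ω) (Y ω) ^ p + edist (Y ω) (Z ω) ^ p ∂P :=
          lintegral_mono fun ω =>
            (ENNReal.rpow_le_rpow (edist_triangle _ (Y ω) _) hp0.le).trans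
              (ENNReal.rpow_add_le_add_rpow _ _ hp0.le hp1.le)
      _ = ∫⁻ ω, edist (X ω) (Y ω) ^ p ∂P + ∫⁻ ω, edist (Y ω) (Z ω) ^ p ∂P :=
          lintegral_add_left ((hX.edist hY).pow_const p) _
      _ ≤ dist_p X Y + dist_p Y Z := add_le_add (hle P hP X Y) (hle P hP Y Z)
  refine ⟨htri, fun X hX hXfin hcau => ?_⟩
  obtain ⟨φ, hφ, hφX⟩ : ∃ φ : ℕ → ℕ, StrictMono φ ∧
      ∀ k, ∀ n ≥ φ k, ∀ m ≥ φ k, dist_p (X n) (X m) < 2⁻¹ ^ k := by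
    refine extraction_forall_of_eventually
      (P := fun k i => ∀ n ≥ i, ∀ m ≥ i, dist_p (X n) (X m) < 2⁻¹ ^ k) fun k => ?_
    obtain ⟨N, hN⟩ := hcau (2⁻¹ ^ k) (ENNReal.pow_pos (by simp) k)
    filter_upwards [eventually_ge_atTop N] with i hi n hn m hm
    exact hN n (hi.trans hn) m (hi.trans hm)
  set Y : Ω → ℝ := fun ω => limUnder atTop fun k => X (φ k) ω
  have hY : Measurable Y :=
    (StronglyMeasurable.limUnder fun k => (hX (φ k)).stronglyMeasurable).measurable
  have hlim : ∀ P ∈ Ps, ∀ᵐ ω ∂P, Tendsto (fun k => X (φ k) ω) atTop (𝓝 (Y ω)) := by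
    intro P hP
    refine ae_tendsto_limUnder_of_tsum_lintegral_edist_rpow_ne_top hp0 hp1.le
      (fun k => hX (φ k)) (ne_top_of_le_ne_top ?_ (ENNReal.tsum_le_tsum fun k =>
        (hle P hP _ _).trans (hφX k _ le_rfl _ (hφ.monotone k.le_succ)).le))
    simp [ENNReal.tsum_geometric]
  have hbound : ∀ ε : ℝ≥0∞, 0 < ε → ∃ N : ℕ, ∀ n ≥ N, dist_p (X n) Y ≤ ε := by
    intro ε hε
    obtain ⟨N, hN⟩ := hcau ε hε
    refine ⟨N, fun n hn => ?_⟩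
    rw [hd]
    refine iSup₂_le fun P hP => lintegral_edist_rpow_le_of_ae_tendsto
      (fun k => hX (φ k)) (hX n) (hlim P hP) ?_
    filter_upwards [eventually_ge_atTop N] with k hk
    exact (hle P hP _ _).trans (hN n hn _ (hk.trans hφ.le_apply)).le
  refine ⟨Y, hY, ?_, ENNReal.tendsto_atTop_zero.2 hbound⟩
  obtain ⟨N, hN⟩ := hbound 1 one_pos
  calc dist_p Y 0 ≤ dist_p Y (X N) + dist_p (X N) 0 := htri _ _ _ hY (hX N) measurable_zero
    _ < ⊤ := ENNReal.add_lt_top.2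
      ⟨hcomm Y (X N) ▸ (hN N le_rfl).trans_lt ENNReal.one_lt_top, hXfin N⟩
end

section
/- (Kolmogorov–Chentsov criterion for càdlàg modification under a capacity.) Let (Ω, ℬ) be a measurable space, 𝒫 a nonempty family of probability measures on (Ω, ℬ), c(A) := sup_{P∈𝒫} P(A) and 𝔼[Y] := sup_{P∈𝒫} ∫ Y dP. Let (X_t)_{t∈[0,1]} be a stochastic process (each X_t : Ω → ℝ measurable) with 𝔼[|X_t|] < ∞ for every t, satisfying: (i) for every t ∈ [0,1] there exists a > 0 such that lim_{s→t} 𝔼[|X_s − X_t|^a] = 0; (ii) there exist constants C, r > 0 and p, q ≥ 0 with p + q > 0 such that for all 0 ≤ s ≤ u ≤ t ≤ 1, 𝔼[|X_t − X_u|^p |X_u − X_s|^q] ≤ C|t − s|^{1+r}. Then X admits a càdlàg modification: there exist a process (Y_t)_{t∈[0,1]} and a measurable set N with c(N) = 0 such that for every ω ∉ N the path t ↦ Y_t(ω) is right-continuous on [0,1) with finite left limits on (0,1], and for every t ∈ [0,1], c({X_t ≠ Y_t}) = 0. -/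
open MeasureTheory Filter Set
open scoped ENNReal Topology

/-- The dyadic rationals, as a set of real numbers. -/
def dyadicReals : Set ℝ := {x | ∃ (M : ℕ) (j : ℤ), x = j / 2 ^ M}

lemma exists_int_div_two_pow_of_le {M M' : ℕ} (h : M ≤ M') (j : ℤ) :
    ∃ i : ℤ, (j : ℝ) / 2 ^ M = i / 2 ^ M' := by
  obtain ⟨d, rfl⟩ := Nat.exists_eq_add_of_le h
  refine ⟨j * 2 ^ d, ?_⟩
  push_cast
  rw [pow_add]
  field_simp

lemma neg_mem_dyadicReals {x : ℝ} (hx : x ∈ dyadicReals) : -x ∈ dyadicReals := by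
  obtain ⟨M, j, rfl⟩ := hx
  exact ⟨M, -j, by push_cast; ring⟩

lemma exists_dyadicReals_between {a b : ℝ} (hab : a < b) :
    ∃ x ∈ dyadicReals, a < x ∧ x < b := by
  obtain ⟨n, hn⟩ := exists_pow_lt_of_lt_one (sub_pos.2 hab) (by norm_num : (1 / 2 : ℝ) < 1)
  have h2 : (0 : ℝ) < 2 ^ n := by positivity
  have hn' : 1 < (b - a) * 2 ^ n := by
    rw [one_div, inv_pow] at hn
    calc (1 : ℝ) = (2 ^ n)⁻¹ * 2 ^ n := by field_simp
      _ < _ := by gcongr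
  refine ⟨((⌊a * 2 ^ n⌋ + 1 : ℤ) : ℝ) / 2 ^ n, ⟨n, _, rfl⟩, ?_, ?_⟩
  · rw [lt_div_iff₀ h2]
    push_cast
    exact Int.lt_floor_add_one _
  · rw [div_lt_iff₀ h2]
    push_cast
    have := Int.floor_le (a * 2 ^ n)
    linarith

lemma nhdsWithin_dyadicReals_inter_Ioi_neBot (t : ℝ) :
    (𝓝[dyadicReals ∩ Ioi t] t).NeBot := by
  rw [← mem_closure_iff_nhdsWithin_neBot, Metric.mem_closure_iff]
  intro ε hε
  obtain ⟨x, hx, h1, h2⟩ := exists_dyadicReals_between (show t < t + ε by linarith)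
  refine ⟨x, ⟨hx, h1⟩, ?_⟩
  rw [Real.dist_eq, abs_sub_lt_iff]
  constructor <;> linarith

/-- Chaining for triples: if at all levels beyond `n` every point of the grid is close to one
of its two neighbours, then among three ordered points in a cell of level `n` the middle one is
close to one of the other two. -/
lemma triple_chaining (g : ℕ → ℤ → ℝ) (hg : ∀ M i, g (M + 1) (2 * i) = g M i)
    (a : ℕ → ℝ) (ha : ∀ M, 0 ≤ a M) (n : ℕ)
    (h : ∀ M, n < M → ∀ j, |g M (j + 1) - g M j| ≤ a M ∨ |g M j - g M (j - 1)| ≤ a M)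
    (c : ℤ) (m : ℕ) : ∀ i j l : ℤ, i ≤ j → j ≤ l → c * 2 ^ m ≤ i → l ≤ (c + 1) * 2 ^ m →
      |g (n + m) j - g (n + m) i| ≤ 2 * ∑ k ∈ Finset.range m, a (n + k + 1) ∨
      |g (n + m) l - g (n + m) j| ≤ 2 * ∑ k ∈ Finset.range m, a (n + k + 1) := by
  induction m with
  | zero =>
    intro i j l hij hjl hi hl
    have : j = i ∨ l = j := by simp at hi hl; omega
    rcases this with rfl | rfl <;> simp
  | succ m ih =>
    intro i j l hij hjl hi hl
    have key : ∀ i : ℤ, ∃ i' : ℤ, 2 * i' - 1 ≤ i ∧ i ≤ 2 * i' + 1 ∧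
        |g (n + (m + 1)) i - g (n + m) i'| ≤ a (n + m + 1) := by
      intro i
      rcases Int.even_or_odd' i with ⟨b, rfl | rfl⟩
      · exact ⟨b, by omega, by omega, by rw [← add_assoc, hg]; simpa using ha _⟩
      · rcases h (n + m + 1) (by omega) (2 * b + 1) with h1 | h1
        · refine ⟨b + 1, by omega, by omega, ?_⟩
          rw [abs_sub_comm, ← hg (n + m)]
          rwa [show 2 * b + 1 + 1 = 2 * (b + 1) by ring] at h1
        · refine ⟨b, by omega, by omega, ?_⟩
          rw [← hg (n + m) b]
          rwa [show 2 * b + 1 - 1 = 2 * b by ring] at h1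
    have key' : ∀ i : ℤ, ∃ i' : ℤ, (i = 2 * i' ∨ i % 2 = 1) ∧ 2 * i' - 1 ≤ i ∧ i ≤ 2 * i' + 1 ∧
        |g (n + (m + 1)) i - g (n + m) i'| ≤ a (n + m + 1) := by
      intro i
      obtain ⟨i', h1, h2, h3⟩ := key i
      exact ⟨i', by omega, h1, h2, h3⟩
    obtain ⟨i', hi1, hi2, hi3, hi4⟩ := key' i
    obtain ⟨j', hj1, hj2, hj3, hj4⟩ := key' j
    obtain ⟨l', hl1, hl2, hl3, hl4⟩ := key' l
    rw [pow_succ, ← mul_assoc] at hi hl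
    rw [abs_le] at hi4 hj4 hl4
    have hij' : i' ≤ j' ∨ i = j := by omega
    have hjl' : j' ≤ l' ∨ j = l := by omega
    have hS : 0 ≤ 2 * ∑ k ∈ Finset.range (m + 1), a (n + k + 1) :=
      mul_nonneg zero_le_two (Finset.sum_nonneg fun _ _ => ha _)
    rcases hij' with hij' | rfl
    swap
    · left; simpa using hS
    rcases hjl' with hjl' | rfl
    swap
    · right; simpa using hS
    rw [Finset.sum_range_succ]
    rcases ih i' j' l' hij' hjl' (by omega) (by omega) with H | H <;> rw [abs_le] at H
    · left; rw [abs_le]; constructor <;> linarith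
    · right; rw [abs_le]; constructor <;> linarith

/-- Beyond some level, every point of the dyadic grid is `θ ^ k`-close, in value, to one of its
two neighbours. -/
def NeighborClose (θ : ℝ) (f : ℝ → ℝ) : Prop :=
  ∃ n₀ : ℕ, ∀ k, n₀ ≤ k → ∀ j : ℤ,
    |f ((j + 1 : ℤ) / 2 ^ k) - f (j / 2 ^ k)| ≤ θ ^ k ∨
      |f (j / 2 ^ k) - f ((j - 1 : ℤ) / 2 ^ k)| ≤ θ ^ k

lemma NeighborClose.comp_neg {θ : ℝ} {f : ℝ → ℝ} (h : NeighborClose θ f) :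
    NeighborClose θ (fun x => f (-x)) := by
  obtain ⟨n₀, h⟩ := h
  refine ⟨n₀, fun k hk j => ?_⟩
  have e1 : -(((j + 1 : ℤ) : ℝ) / 2 ^ k) = ((-j - 1 : ℤ) : ℝ) / 2 ^ k := by push_cast; ring
  have e2 : -((j : ℝ) / 2 ^ k) = ((-j : ℤ) : ℝ) / 2 ^ k := by push_cast; ring
  have e3 : -(((j - 1 : ℤ) : ℝ) / 2 ^ k) = ((-j + 1 : ℤ) : ℝ) / 2 ^ k := by push_cast; ring
  simp only [e1, e2, e3]
  rcases h k hk (-j) with h | h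
  · right; rwa [abs_sub_comm]
  · left; rwa [abs_sub_comm]

lemma NeighborClose.exists_triple {θ : ℝ} (hθ0 : 0 < θ) (hθ1 : θ < 1) {f : ℝ → ℝ}
    (h : NeighborClose θ f) (t : ℝ) {ε : ℝ} (hε : 0 < ε) :
    ∃ e > t, ∀ s ∈ dyadicReals, ∀ u ∈ dyadicReals, ∀ v ∈ dyadicReals,
      t < s → s ≤ u → u ≤ v → v < e → |f u - f s| < ε ∨ |f v - f u| < ε := by
  obtain ⟨n₀, h⟩ := h
  have hθ : 0 < 1 - θ := by linarith
  obtain ⟨n₁, hn₁⟩ := exists_pow_lt_of_lt_one (show 0 < ε * (1 - θ) / 2 by positivity) hθ1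
  set n := max n₀ n₁ with hn
  have hθn : θ ^ n < ε * (1 - θ) / 2 :=
    (pow_le_pow_of_le_one hθ0.le hθ1.le (le_max_right _ _)).trans_lt hn₁
  have hsum : ∀ m, 2 * ∑ k ∈ Finset.range m, θ ^ (n + k + 1) < ε := by
    intro m
    have h1 : ∑ k ∈ Finset.range m, θ ^ (n + k + 1) = θ ^ n * θ * ∑ k ∈ Finset.range m, θ ^ k := by
      rw [Finset.mul_sum]
      exact Finset.sum_congr rfl fun k _ => by ring
    have h2 : (∑ k ∈ Finset.range m, θ ^ k) * (1 - θ) = 1 - θ ^ m := geom_sum_mul_neg θ m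
    have h3 : ∑ k ∈ Finset.range m, θ ^ k ≤ 1 / (1 - θ) := by
      rw [le_div_iff₀ hθ, h2]
      have : 0 < θ ^ m := by positivity
      linarith
    calc 2 * ∑ k ∈ Finset.range m, θ ^ (n + k + 1)
        ≤ 2 * (θ ^ n * 1 * (1 / (1 - θ))) := by
          rw [h1]
          gcongr
      _ < 2 * (ε * (1 - θ) / 2 * 1 * (1 / (1 - θ))) := by gcongr
      _ = ε := by field_simp
  have h2n : (0 : ℝ) < 2 ^ n := by positivity
  set c := ⌊t * 2 ^ n⌋ with hc
  refine ⟨((c : ℝ) + 1) / 2 ^ n, ?_, ?_⟩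
  · rw [gt_iff_lt, lt_div_iff₀ h2n]
    exact Int.lt_floor_add_one _
  rintro _ ⟨M₁, j₁, rfl⟩ _ ⟨M₂, j₂, rfl⟩ _ ⟨M₃, j₃, rfl⟩ hts hsu huv hve
  set m := max M₁ (max M₂ M₃) with hm
  obtain ⟨i, hi⟩ := exists_int_div_two_pow_of_le (show M₁ ≤ n + m by omega) j₁
  obtain ⟨j, hj⟩ := exists_int_div_two_pow_of_le (show M₂ ≤ n + m by omega) j₂
  obtain ⟨l, hl⟩ := exists_int_div_two_pow_of_le (show M₃ ≤ n + m by omega) j₃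
  rw [hi] at hts hsu ⊢
  rw [hj] at hsu huv ⊢
  rw [hl] at huv hve ⊢
  have hp : (0 : ℝ) < 2 ^ (n + m) := by positivity
  have h2m : (0 : ℝ) < 2 ^ m := by positivity
  have hij : i ≤ j := by
    rw [div_le_div_iff_of_pos_right hp] at hsu
    exact_mod_cast hsu
  have hjl : j ≤ l := by
    rw [div_le_div_iff_of_pos_right hp] at huv
    exact_mod_cast huv
  have hci : c * 2 ^ m ≤ i := by
    rw [lt_div_iff₀ hp, pow_add, ← mul_assoc] at hts
    have h1 : (c : ℝ) * 2 ^ m ≤ t * 2 ^ n * 2 ^ m := by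
      gcongr
      exact Int.floor_le _
    exact_mod_cast h1.trans hts.le
  have hlc : l ≤ (c + 1) * 2 ^ m := by
    rw [div_lt_div_iff₀ hp h2n, pow_add] at hve
    have h1 : (l : ℝ) * 2 ^ n < ((c : ℝ) + 1) * 2 ^ m * 2 ^ n := by linarith
    have h2 := lt_of_mul_lt_mul_right h1 h2n.le
    exact_mod_cast h2.le
  have := triple_chaining (fun M i => f (i / 2 ^ M))
    (fun M i => by
      congr 1
      push_cast
      rw [pow_succ]
      field_simp)
    (fun k => θ ^ k) (fun k => by positivity) n
    (fun M hM j => h M (by omega) j) c m i j l hij hjl hci hlc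
  exact this.imp (fun H => H.trans_lt (hsum m)) (fun H => H.trans_lt (hsum m))

lemma NeighborClose.exists_tendsto_right {θ : ℝ} (hθ0 : 0 < θ) (hθ1 : θ < 1) {f : ℝ → ℝ}
    (h : NeighborClose θ f) (t : ℝ) :
    ∃ L, Tendsto f (𝓝[dyadicReals ∩ Ioi t] t) (𝓝 L) := by
  have hne := nhdsWithin_dyadicReals_inter_Ioi_neBot t
  rw [← cauchy_map_iff_exists_tendsto, Metric.cauchy_iff]
  refine ⟨hne.map f, fun ε hε => ?_⟩
  obtain ⟨e, he, H⟩ := h.exists_triple hθ0 hθ1 t (half_pos hε)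
  by_contra! hcon
  have pair : ∀ e' > t, ∃ s ∈ dyadicReals, ∃ u ∈ dyadicReals, t < s ∧ s < u ∧ u < e' ∧
      ε ≤ |f u - f s| := by
    intro e' he'
    have hmem : f '' (dyadicReals ∩ Ioi t ∩ Iio e') ∈ map f (𝓝[dyadicReals ∩ Ioi t] t) :=
      image_mem_map (inter_mem self_mem_nhdsWithin (mem_nhdsWithin_of_mem_nhds (Iio_mem_nhds he')))
    obtain ⟨_, ⟨x, ⟨⟨hx, hx1⟩, hx2⟩, rfl⟩, _, ⟨y, ⟨⟨hy, hy1⟩, hy2⟩, rfl⟩, hxy⟩ := hcon _ hmem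
    rw [Real.dist_eq] at hxy
    rcases lt_trichotomy x y with hlt | rfl | hlt
    · exact ⟨x, hx, y, hy, hx1, hlt, hy2, by rwa [abs_sub_comm]⟩
    · simp at hxy; linarith
    · exact ⟨y, hy, x, hx, hy1, hlt, hx2, hxy⟩
  obtain ⟨s, hs, u, hu, hts, hsu, hue, h1⟩ := pair e he
  obtain ⟨s', hs', u', hu', hts', hsu', hue', h2⟩ := pair s hts
  have a1 := H s' hs' u' hu' s hs hts' hsu'.le hue'.le (hsu.trans hue)
  have a2 := H s' hs' u' hu' u hu hts' hsu'.le (hue'.le.trans hsu.le) hue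
  have a1' := a1.resolve_left (by linarith)
  have a2' := a2.resolve_left (by linarith)
  have := abs_sub_le (f u) (f u') (f s)
  rw [abs_sub_comm (f u') (f s)] at this
  linarith

lemma NeighborClose.exists_tendsto_left {θ : ℝ} (hθ0 : 0 < θ) (hθ1 : θ < 1) {f : ℝ → ℝ}
    (h : NeighborClose θ f) (t : ℝ) :
    ∃ L, Tendsto f (𝓝[dyadicReals ∩ Iio t] t) (𝓝 L) := by
  obtain ⟨L, hL⟩ := h.comp_neg.exists_tendsto_right hθ0 hθ1 (-t)
  refine ⟨L, ?_⟩
  have hneg : Tendsto (fun x : ℝ => -x) (𝓝[dyadicReals ∩ Iio t] t)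
      (𝓝[dyadicReals ∩ Ioi (-t)] (-t)) := by
    refine tendsto_nhdsWithin_iff.2
      ⟨(continuous_neg.tendsto t).mono_left nhdsWithin_le_nhds, ?_⟩
    filter_upwards [self_mem_nhdsWithin] with x hx
    exact ⟨neg_mem_dyadicReals hx.1, neg_lt_neg (mem_Iio.1 hx.2)⟩
  simpa [Function.comp_def] using hL.comp hneg

lemma mem_of_tendsto_dyadicReals {f : ℝ → ℝ} {s y : ℝ}
    (h : Tendsto f (𝓝[dyadicReals ∩ Ioi s] s) (𝓝 y)) {U K : Set ℝ} (hU : IsOpen U)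
    (hK : IsClosed K) (hUK : ∀ x ∈ dyadicReals, x ∈ U → f x ∈ K) (hs : s ∈ U) : y ∈ K := by
  have hne := nhdsWithin_dyadicReals_inter_Ioi_neBot s
  refine hK.mem_of_tendsto h ?_
  filter_upwards [self_mem_nhdsWithin, mem_nhdsWithin_of_mem_nhds (hU.mem_nhds hs)] with x hx hxU
  exact hUK x hx.1 hxU

/-- Limits of `f` along the dyadics pass to its right-limit regularization `g`. -/
lemma tendsto_of_tendsto_dyadicReals {f g : ℝ → ℝ}
    (h : ∀ s, Tendsto f (𝓝[dyadicReals ∩ Ioi s] s) (𝓝 (g s))) {V : Set ℝ} (hV : IsOpen V)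
    {t L : ℝ} (hL : Tendsto f (𝓝[dyadicReals ∩ V] t) (𝓝 L)) :
    Tendsto g (𝓝[V] t) (𝓝 L) := by
  rw [(closed_nhds_basis L).tendsto_right_iff]
  rintro K ⟨hK, hKc⟩
  obtain ⟨U, hU, htU, hUK⟩ := mem_nhdsWithin.1 (hL hK)
  filter_upwards [self_mem_nhdsWithin, mem_nhdsWithin_of_mem_nhds (hU.mem_nhds htU)] with s hs hsU
  exact mem_of_tendsto_dyadicReals (h s) (hU.inter hV) hKc
    (fun x hx hxU => hUK ⟨hxU.1, hx, hxU.2⟩) ⟨hsU, hs⟩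

/-- Projection of the real line onto `[0, 1]`. -/
noncomputable def clampUnit (x : ℝ) : ℝ := max 0 (min x 1)

lemma clampUnit_mem (x : ℝ) : clampUnit x ∈ Icc (0 : ℝ) 1 :=
  ⟨le_max_left _ _, max_le zero_le_one (min_le_right _ _)⟩

lemma clampUnit_of_mem {x : ℝ} (hx : x ∈ Icc (0 : ℝ) 1) : clampUnit x = x := by
  rw [clampUnit, min_eq_left hx.2, max_eq_right hx.1]

lemma clampUnit_of_nonpos {x : ℝ} (hx : x ≤ 0) : clampUnit x = 0 :=
  max_eq_left ((min_le_left _ _).trans hx)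

lemma clampUnit_of_one_le {x : ℝ} (hx : 1 ≤ x) : clampUnit x = 1 := by
  rw [clampUnit, min_eq_right hx, max_eq_right zero_le_one]

lemma continuous_clampUnit : Continuous clampUnit := by
  unfold clampUnit
  fun_prop

/-- For a path extended by constants outside `[0, 1]`, only the interior grid points matter. -/
lemma neighborClose_comp_clampUnit {θ : ℝ} (hθ0 : 0 < θ) {f : ℝ → ℝ} {n₀ : ℕ}
    (h : ∀ k, n₀ ≤ k → ∀ j ∈ Finset.Ioo (0 : ℤ) (2 ^ k),
      |f ((j + 1 : ℤ) / 2 ^ k) - f (j / 2 ^ k)| ≤ θ ^ k ∨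
        |f (j / 2 ^ k) - f ((j - 1 : ℤ) / 2 ^ k)| ≤ θ ^ k) :
    NeighborClose θ (fun x => f (clampUnit x)) := by
  refine ⟨n₀, fun k hk j => ?_⟩
  have h2 : (0 : ℝ) < 2 ^ k := by positivity
  have hθk : 0 ≤ θ ^ k := by positivity
  rcases le_or_gt j 0 with hj | hj
  · right
    have hj' : (j : ℝ) ≤ 0 := by exact_mod_cast hj
    have hj'' : ((j - 1 : ℤ) : ℝ) ≤ 0 := by push_cast; linarith
    simp only [clampUnit_of_nonpos (div_nonpos_of_nonpos_of_nonneg hj' h2.le),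
      clampUnit_of_nonpos (div_nonpos_of_nonpos_of_nonneg hj'' h2.le)]
    simpa using hθk
  rcases le_or_gt (2 ^ k) j with hj2 | hj2
  · left
    have hj' : (2 : ℝ) ^ k ≤ j := by exact_mod_cast hj2
    have hj'' : (2 : ℝ) ^ k ≤ ((j + 1 : ℤ) : ℝ) := by push_cast; linarith
    simp only [clampUnit_of_one_le ((one_le_div h2).2 hj'),
      clampUnit_of_one_le ((one_le_div h2).2 hj'')]
    simpa using hθk
  · have mem : ∀ i : ℤ, 0 ≤ i → i ≤ 2 ^ k → clampUnit ((i : ℝ) / 2 ^ k) = i / 2 ^ k := by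
      intro i hi1 hi2
      refine clampUnit_of_mem ⟨by positivity, (div_le_one h2).2 (by exact_mod_cast hi2)⟩
    simp only [mem (j + 1) (by omega) (by omega), mem j hj.le hj2.le,
      mem (j - 1) (by omega) (by omega)]
    exact h k hk j (Finset.mem_Ioo.2 ⟨hj, hj2⟩)

section Probability

variable {Ω : Type*} [MeasurableSpace Ω]

/-- The event that at level `k` some interior grid point is far, in value, from both of its
neighbours. -/
def farEvent (X : ℝ → Ω → ℝ) (θ : ℝ) (k : ℕ) : Set Ω :=
  ⋃ j ∈ Finset.Ioo (0 : ℤ) (2 ^ k),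
    {ω | θ ^ k < |X ((j + 1 : ℤ) / 2 ^ k) ω - X (j / 2 ^ k) ω| ∧
      θ ^ k < |X (j / 2 ^ k) ω - X ((j - 1 : ℤ) / 2 ^ k) ω|}

lemma measurableSet_farEvent {X : ℝ → Ω → ℝ} (hX : ∀ t, Measurable (X t)) (θ : ℝ) (k : ℕ) :
    MeasurableSet (farEvent X θ k) := by
  refine Finset.measurableSet_biUnion _ fun j _ => ?_
  exact (measurableSet_lt measurable_const ((hX _).sub (hX _)).abs).inter
    (measurableSet_lt measurable_const ((hX _).sub (hX _)).abs)

lemma measure_both_far_le {P : Measure Ω} {f g : Ω → ℝ} (hf : Measurable f)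
    (hg : Measurable g) {p q x B : ℝ} (hp : 0 ≤ p) (hq : 0 ≤ q) (hx : 0 < x)
    (h : ∫⁻ ω, ENNReal.ofReal (|f ω| ^ p * |g ω| ^ q) ∂P ≤ ENNReal.ofReal B) :
    P {ω | x < |f ω| ∧ x < |g ω|} ≤ ENNReal.ofReal (B / x ^ (p + q)) := by
  have hxp : 0 < x ^ (p + q) := Real.rpow_pos_of_pos hx _
  have hmeas : Measurable fun ω => ENNReal.ofReal (|f ω| ^ p * |g ω| ^ q) := by fun_prop
  calc P {ω | x < |f ω| ∧ x < |g ω|}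
      ≤ P {ω | ENNReal.ofReal (x ^ (p + q)) ≤ ENNReal.ofReal (|f ω| ^ p * |g ω| ^ q)} := by
        refine measure_mono fun ω hω => ENNReal.ofReal_le_ofReal ?_
        rw [Real.rpow_add hx]
        exact mul_le_mul (Real.rpow_le_rpow hx.le hω.1.le hp) (Real.rpow_le_rpow hx.le hω.2.le hq)
          (by positivity) (by positivity)
    _ ≤ (∫⁻ ω, ENNReal.ofReal (|f ω| ^ p * |g ω| ^ q) ∂P) / ENNReal.ofReal (x ^ (p + q)) :=
        meas_ge_le_lintegral_div hmeas.aemeasurable (by simpa using hxp) ENNReal.ofReal_ne_top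
    _ ≤ ENNReal.ofReal B / ENNReal.ofReal (x ^ (p + q)) := by gcongr
    _ = _ := (ENNReal.ofReal_div_of_pos hxp).symm

lemma measure_farEvent_le {X : ℝ → Ω → ℝ} (hX : ∀ t, Measurable (X t)) {P : Measure Ω}
    {C r p q : ℝ} (hC : 0 < C) (hp : 0 ≤ p) (hq : 0 ≤ q) (hpq : 0 < p + q)
    (h : ∀ s u t : ℝ, 0 ≤ s → s ≤ u → u ≤ t → t ≤ 1 →
      ∫⁻ ω, ENNReal.ofReal (|X t ω - X u ω| ^ p * |X u ω - X s ω| ^ q) ∂P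
        ≤ ENNReal.ofReal (C * (t - s) ^ (1 + r))) (k : ℕ) :
    P (farEvent X (2 ^ (-(r / (2 * (p + q))))) k) ≤
      ENNReal.ofReal (C * 2 ^ (1 + r) * ((2 : ℝ) ^ (-(r / 2))) ^ k) := by
  set θ : ℝ := 2 ^ (-(r / (2 * (p + q)))) with hθ
  have hθ0 : 0 < θ := by positivity
  have h2 : (0 : ℝ) < 2 ^ k := by positivity
  set B : ℝ := C * (2 / 2 ^ k) ^ (1 + r) / (θ ^ k) ^ (p + q) with hB
  have hB0 : 0 ≤ B := by positivity
  have hone : ∀ j ∈ Finset.Ioo (0 : ℤ) (2 ^ k),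
      P {ω | θ ^ k < |X ((j + 1 : ℤ) / 2 ^ k) ω - X (j / 2 ^ k) ω| ∧
        θ ^ k < |X (j / 2 ^ k) ω - X ((j - 1 : ℤ) / 2 ^ k) ω|} ≤ ENNReal.ofReal B := by
    intro j hj
    rw [Finset.mem_Ioo] at hj
    refine measure_both_far_le ((hX _).sub (hX _)) ((hX _).sub (hX _)) hp hq (by positivity) ?_
    have hlow : (0 : ℝ) ≤ ((j - 1 : ℤ) : ℝ) := by
      exact_mod_cast (by omega : (0 : ℤ) ≤ j - 1)
    have hup : ((j + 1 : ℤ) : ℝ) ≤ 2 ^ k := by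
      exact_mod_cast (by omega : j + 1 ≤ 2 ^ k)
    refine (h (((j - 1 : ℤ) : ℝ) / 2 ^ k) ((j : ℝ) / 2 ^ k) (((j + 1 : ℤ) : ℝ) / 2 ^ k)
      (by positivity) ?_ ?_ ((div_le_one h2).2 hup)).trans_eq ?_
    · gcongr; omega
    · gcongr; omega
    · congr 3
      push_cast
      ring
  calc P (farEvent X θ k) ≤ ∑ j ∈ Finset.Ioo (0 : ℤ) (2 ^ k),
        P {ω | θ ^ k < |X ((j + 1 : ℤ) / 2 ^ k) ω - X (j / 2 ^ k) ω| ∧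
          θ ^ k < |X (j / 2 ^ k) ω - X ((j - 1 : ℤ) / 2 ^ k) ω|} := measure_biUnion_finset_le _ _
    _ ≤ (Finset.Ioo (0 : ℤ) (2 ^ k)).card • ENNReal.ofReal B := Finset.sum_le_card_nsmul _ _ _ hone
    _ ≤ (2 ^ k : ℕ) • ENNReal.ofReal B := by
        gcongr
        rw [Int.card_Ioo]
        have hcast : ((2 : ℤ) ^ k) = ((2 ^ k : ℕ) : ℤ) := by push_cast; rfl
        have hpos : 0 < 2 ^ k := Nat.two_pow_pos k
        rw [hcast]
        omega
    _ = ENNReal.ofReal (2 ^ k * B) := by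
        rw [nsmul_eq_mul, ENNReal.ofReal_mul h2.le]
        congr 1
        rw [← ENNReal.ofReal_natCast]
        push_cast
        rfl
    _ = _ := by
        congr 1
        have e1 : (θ ^ k) ^ (p + q) = (2 : ℝ) ^ (-(r / 2) * k) := by
          rw [hθ, ← Real.rpow_natCast, ← Real.rpow_mul zero_le_two, ← Real.rpow_mul zero_le_two]
          congr 1
          field_simp
        have e2 : (2 / 2 ^ k : ℝ) ^ (1 + r) = 2 ^ (1 + r) / 2 ^ (k * (1 + r)) := by
          rw [Real.div_rpow zero_le_two h2.le, ← Real.rpow_natCast, ← Real.rpow_mul zero_le_two]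
        have e3 : ((2 : ℝ) ^ (-(r / 2))) ^ k = 2 ^ (-(r / 2) * k) := by
          rw [← Real.rpow_natCast, ← Real.rpow_mul zero_le_two]
        have e4 : (2 : ℝ) ^ (k * (1 + r)) =
            2 ^ k / (2 ^ (-(r / 2) * k) * 2 ^ (-(r / 2) * k)) := by
          rw [← Real.rpow_add zero_lt_two, ← Real.rpow_natCast, ← Real.rpow_sub zero_lt_two]
          congr 1
          ring
        rw [hB, e1, e2, e3, e4]
        field_simp

lemma ae_eq_of_tendsto_lintegral_rpow {P : Measure Ω} {Z : ℕ → Ω → ℝ} {W V : Ω → ℝ}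
    (hZ : ∀ n, Measurable (Z n)) (hW : Measurable W) {a : ℝ} (ha : 0 < a)
    (hlim : Tendsto (fun n => ∫⁻ ω, ENNReal.ofReal (|Z n ω - W ω| ^ a) ∂P) atTop (𝓝 0))
    (hV : ∀ᵐ ω ∂P, Tendsto (fun n => Z n ω) atTop (𝓝 (V ω))) : ∀ᵐ ω ∂P, W ω = V ω := by
  have hmeas : ∀ n, Measurable fun ω => ENNReal.ofReal (|Z n ω - W ω| ^ a) := by
    intro n
    have := hZ n
    fun_prop
  have h0 : ∫⁻ ω, liminf (fun n => ENNReal.ofReal (|Z n ω - W ω| ^ a)) atTop ∂P = 0 := by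
    refine le_antisymm ((lintegral_liminf_le hmeas).trans ?_) zero_le
    rw [hlim.liminf_eq]
  rw [lintegral_eq_zero_iff (Measurable.liminf hmeas)] at h0
  filter_upwards [h0, hV] with ω h1 h2
  have h3 : Tendsto (fun n => ENNReal.ofReal (|Z n ω - W ω| ^ a)) atTop
      (𝓝 (ENNReal.ofReal (|V ω - W ω| ^ a))) :=
    ENNReal.tendsto_ofReal ((h2.sub_const _).abs.rpow_const (Or.inr ha.le))
  rw [h3.liminf_eq, Pi.zero_apply, ENNReal.ofReal_eq_zero] at h1
  by_contra hne
  have : 0 < |V ω - W ω| ^ a := Real.rpow_pos_of_pos (abs_pos.2 (sub_ne_zero.2 (Ne.symm hne))) _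
  linarith

end Probability

/-- Kolmogorov–Chentsov criterion for a càdlàg modification under the upper capacity
`c(A) = sup_{P ∈ Ps} P(A)`: if `(X_t)_{t ∈ [0,1]}` has finite upper expectation, is
continuous in upper `a`-th mean at every point, and satisfies the two-increment moment bound
`𝔼[|X_t - X_u|^p |X_u - X_s|^q] ≤ C |t-s|^{1+r}`, then there is a modification `Y` of `X`
whose sample paths outside a polar set are right-continuous on `[0,1)` with finite left
limits on `(0,1]`. -/
theorem stmt_10 {Ω : Type*} [MeasurableSpace Ω] (Ps : Set (Measure Ω))
    (hPs : Ps.Nonempty) (hprob : ∀ P ∈ Ps, IsProbabilityMeasure P)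
    (X : ℝ → Ω → ℝ) (hXmeas : ∀ t, Measurable (X t))
    (hXint : ∀ t ∈ Set.Icc (0:ℝ) 1,
      (⨆ P ∈ Ps, ∫⁻ ω, ENNReal.ofReal |X t ω| ∂P) < ⊤)
    (hi : ∀ t ∈ Set.Icc (0:ℝ) 1, ∃ a : ℝ, 0 < a ∧
      Tendsto (fun s => ⨆ P ∈ Ps, ∫⁻ ω, ENNReal.ofReal (|X s ω - X t ω| ^ a) ∂P)
        (𝓝[Set.Icc (0:ℝ) 1] t) (𝓝 0))
    (hii : ∃ C r p q : ℝ, 0 < C ∧ 0 < r ∧ 0 ≤ p ∧ 0 ≤ q ∧ 0 < p + q ∧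
      ∀ s u t : ℝ, 0 ≤ s → s ≤ u → u ≤ t → t ≤ 1 →
        (⨆ P ∈ Ps, ∫⁻ ω, ENNReal.ofReal (|X t ω - X u ω| ^ p * |X u ω - X s ω| ^ q) ∂P)
          ≤ ENNReal.ofReal (C * (t - s) ^ (1 + r))) :
    ∃ Y : ℝ → Ω → ℝ, ∃ N : Set Ω, MeasurableSet N ∧ (⨆ P ∈ Ps, P N) = 0 ∧
      (∀ ω ∉ N,
        (∀ t ∈ Set.Ico (0:ℝ) 1,
          Tendsto (fun s => Y s ω) (𝓝[Set.Ioc t 1] t) (𝓝 (Y t ω))) ∧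
        (∀ t ∈ Set.Ioc (0:ℝ) 1, ∃ L : ℝ,
          Tendsto (fun s => Y s ω) (𝓝[Set.Ico 0 t] t) (𝓝 L))) ∧
      ∀ t ∈ Set.Icc (0:ℝ) 1, (⨆ P ∈ Ps, P {ω | X t ω ≠ Y t ω}) = 0 := by
  obtain ⟨C, r, p, q, hC, hr, hp, hq, hpq, hii⟩ := hii
  set θ : ℝ := 2 ^ (-(r / (2 * (p + q)))) with hθ
  have hθ0 : 0 < θ := by positivity
  have hθ1 : θ < 1 := Real.rpow_lt_one_of_one_lt_of_neg one_lt_two (by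
    have : 0 < r / (2 * (p + q)) := by positivity
    linarith)
  set N : Set Ω := limsup (farEvent X θ) atTop with hN
  have hNmeas : MeasurableSet N :=
    MeasurableSet.measurableSet_limsup fun k => measurableSet_farEvent hXmeas θ k
  have hNnull : ∀ P ∈ Ps, P N = 0 := by
    intro P hP
    refine measure_limsup_atTop_eq_zero ?_
    have hρ : (2 : ℝ) ^ (-(r / 2)) < 1 :=
      Real.rpow_lt_one_of_one_lt_of_neg one_lt_two (by linarith)
    have hs : Summable fun k : ℕ => C * 2 ^ (1 + r) * ((2 : ℝ) ^ (-(r / 2))) ^ k :=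
      (summable_geometric_of_lt_one (by positivity) hρ).mul_left _
    refine ne_top_of_le_ne_top hs.tsum_ofReal_ne_top (ENNReal.tsum_le_tsum fun k => ?_)
    exact measure_farEvent_le hXmeas hC hp hq hpq (fun s u t h1 h2 h3 h4 =>
      (le_iSup₂ (f := fun P (_ : P ∈ Ps) => ∫⁻ ω, ENNReal.ofReal
        (|X t ω - X u ω| ^ p * |X u ω - X s ω| ^ q) ∂P) P hP).trans (hii s u t h1 h2 h3 h4)) k
  have hclose : ∀ ω ∉ N, NeighborClose θ (fun x => X (clampUnit x) ω) := by
    intro ω hω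
    rw [hN, mem_limsup_iff_frequently_mem, not_frequently, eventually_atTop] at hω
    obtain ⟨n₀, hn₀⟩ := hω
    refine neighborClose_comp_clampUnit (f := fun x => X x ω) hθ0 (n₀ := n₀) fun k hk j hj => ?_
    by_contra! hcon
    exact hn₀ k hk (mem_iUnion₂.2 ⟨j, hj, hcon⟩)
  have hex : ∀ t ω, ∃ y, ω ∉ N →
      Tendsto (fun x => X (clampUnit x) ω) (𝓝[dyadicReals ∩ Ioi t] t) (𝓝 y) := by
    intro t ω
    by_cases hω : ω ∈ N
    · exact ⟨0, fun h => absurd hω h⟩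
    · obtain ⟨y, hy⟩ := (hclose ω hω).exists_tendsto_right hθ0 hθ1 t
      exact ⟨y, fun _ => hy⟩
  choose Y hY using hex
  refine ⟨Y, N, hNmeas, by simpa using hNnull, fun ω hω => ⟨fun t _ => ?_, fun t _ => ?_⟩, ?_⟩
  · exact (tendsto_of_tendsto_dyadicReals (fun s => hY s ω hω) isOpen_Ioi (hY t ω hω)).mono_left
      (nhdsWithin_mono _ Ioc_subset_Ioi_self)
  · obtain ⟨L, hL⟩ := (hclose ω hω).exists_tendsto_left hθ0 hθ1 t
    exact ⟨L, (tendsto_of_tendsto_dyadicReals (fun s => hY s ω hω) isOpen_Iio hL).mono_left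
      (nhdsWithin_mono _ Ico_subset_Iio_self)⟩
  · intro t ht
    simp only [ENNReal.iSup_eq_zero]
    intro P hP
    obtain ⟨a, ha, hlim⟩ := hi t ht
    have hne := nhdsWithin_dyadicReals_inter_Ioi_neBot t
    obtain ⟨d, hd⟩ := exists_seq_tendsto (𝓝[dyadicReals ∩ Ioi t] t)
    have hcd : Tendsto (fun n => clampUnit (d n)) atTop (𝓝[Icc (0 : ℝ) 1] t) := by
      refine tendsto_nhdsWithin_iff.2 ⟨?_, Eventually.of_forall fun n => clampUnit_mem _⟩
      have := (continuous_clampUnit.tendsto t).comp (hd.mono_right nhdsWithin_le_nhds)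
      rwa [clampUnit_of_mem ht] at this
    refine ae_iff.1 (ae_eq_of_tendsto_lintegral_rpow (Z := fun n => X (clampUnit (d n)))
      (fun n => hXmeas _) (hXmeas t) ha ?_ ?_)
    · refine tendsto_of_tendsto_of_tendsto_of_le_of_le tendsto_const_nhds (hlim.comp hcd)
        (fun _ => zero_le) fun n => ?_
      exact le_iSup₂ (f := fun P (_ : P ∈ Ps) => ∫⁻ ω, ENNReal.ofReal
        (|X (clampUnit (d n)) ω - X t ω| ^ a) ∂P) P hP
    · filter_upwards [measure_eq_zero_iff_ae_notMem.1 (hNnull P hP)] with ω hω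
      exact (hY t ω hω).comp hd
end

section
/- Let Ω̄ = (ℝ^d)^{[0,∞)} with canonical process B̄_t(ω̄) = ω̄(t), ℬ(Ω̄) the σ-algebra generated by all finite-dimensional cylinder sets, and L_ip(Ω̄) := {φ(B̄_{t₁}, …, B̄_{t_n}) : n ∈ ℕ, t₁, …, t_n ∈ [0,∞), φ bounded Lipschitz on (ℝ^d)^n}. Let Ē : L_ip(Ω̄) → ℝ be a sublinear expectation (monotone, constant preserving, subadditive, positively homogeneous) such that for every m ∈ ℕ, all 0 ≤ t₁ < ⋯ < t_m < ∞ and every sequence (φ_n) of bounded Lipschitz functions on (ℝ^d)^m with φ_n ↓ 0 pointwise, Ē[φ_n(B̄_{t₁}, …, B̄_{t_m})] ↓ 0. Then there exists a family 𝒫_e of probability measures on (Ω̄, ℬ(Ω̄)) such that Ē[X] = max_{Q∈𝒫_e} ∫_{Ω̄} X dQ for every X ∈ L_ip(Ω̄), the maximum being attained. -/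
open MeasureTheory Filter Set
open scoped ENNReal NNReal Topology

/-- The space `Ω̄ = (ℝ^d)^{[0,∞)}` of all `ℝ^d`-valued functions on `[0,∞)`, carrying the
product (cylinder) σ-algebra. -/
abbrev PathSpace (d : ℕ) := ℝ≥0 → (Fin d → ℝ)

/-- The space `L_ip(Ω̄)` of bounded Lipschitz cylinder functions
`φ(B̄_{t₁}, …, B̄_{t_n})` on `Ω̄`. -/
def LipCyl (d : ℕ) : Set (PathSpace d → ℝ) :=
  {X | ∃ (n : ℕ) (t : Fin n → ℝ≥0) (φ : (Fin n → Fin d → ℝ) → ℝ),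
    (∃ K : ℝ≥0, LipschitzWith K φ) ∧ (∃ M : ℝ, ∀ x, |φ x| ≤ M) ∧
    X = fun ω => φ (fun i => ω (t i))}

open scoped BoundedContinuousFunction CompactlySupported

namespace LipCyl

variable {d : ℕ}

lemma const_mem (c : ℝ) : (fun _ => c) ∈ LipCyl d :=
  ⟨0, Fin.elim0, fun _ => c, ⟨0, LipschitzWith.const c⟩, ⟨|c|, fun _ => le_rfl⟩, rfl⟩

lemma add_mem {X Y : PathSpace d → ℝ} (hX : X ∈ LipCyl d) (hY : Y ∈ LipCyl d) :
    X + Y ∈ LipCyl d := by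
  obtain ⟨n, t, φ, ⟨K, hK⟩, ⟨M, hM⟩, rfl⟩ := hX
  obtain ⟨m, s, ψ, ⟨K', hK'⟩, ⟨M', hM'⟩, rfl⟩ := hY
  refine ⟨n + m, Fin.append t s,
    fun x => φ (fun i => x (Fin.castAdd m i)) + ψ (fun i => x (Fin.natAdd n i)),
    ⟨K * 1 + K' * 1, ?_⟩, ⟨M + M', fun x => (abs_add_le _ _).trans (add_le_add (hM _) (hM' _))⟩, ?_⟩
  · refine (hK.comp ?_).add (hK'.comp ?_)
    · exact LipschitzWith.of_edist_le fun x y =>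
        edist_pi_le_iff.2 fun i => edist_le_pi_edist x y (Fin.castAdd m i)
    · exact LipschitzWith.of_edist_le fun x y =>
        edist_pi_le_iff.2 fun i => edist_le_pi_edist x y (Fin.natAdd n i)
  · ext ω
    simp

lemma smul_mem (c : ℝ) {X : PathSpace d → ℝ} (hX : X ∈ LipCyl d) : c • X ∈ LipCyl d := by
  obtain ⟨n, t, φ, ⟨K, hK⟩, ⟨M, hM⟩, rfl⟩ := hX
  refine ⟨n, t, fun x => c * φ x, ⟨_, (lipschitzWith_smul c).comp hK⟩, ⟨|c| * M, fun x => ?_⟩, rfl⟩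
  rw [abs_mul]
  exact mul_le_mul_of_nonneg_left (hM x) (abs_nonneg c)

lemma exists_boundedContinuousFunction {X : PathSpace d → ℝ} (hX : X ∈ LipCyl d) :
    ∃ f : PathSpace d →ᵇ ℝ, ⇑f = X := by
  obtain ⟨n, t, φ, ⟨K, hK⟩, ⟨M, hM⟩, rfl⟩ := hX
  exact ⟨BoundedContinuousFunction.ofNormedAddCommGroup _
    (hK.continuous.comp (by fun_prop)) M fun _ => hM _, rfl⟩

lemma measurable {X : PathSpace d → ℝ} (hX : X ∈ LipCyl d) : Measurable X := by
  obtain ⟨n, t, φ, ⟨K, hK⟩, -, rfl⟩ := hX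
  exact hK.continuous.measurable.comp (by fun_prop)

end LipCyl

/-- A sublinear functional is the pointwise maximum of the linear functionals it dominates. -/
lemma exists_linearMap_eq_of_sublinear {V : Type*} [AddCommGroup V] [Module ℝ V] (N : V → ℝ)
    (N_hom : ∀ c : ℝ, 0 < c → ∀ x, N (c • x) = c * N x)
    (N_add : ∀ x y, N (x + y) ≤ N x + N y) (x₀ : V) :
    ∃ g : V →ₗ[ℝ] ℝ, g x₀ = N x₀ ∧ ∀ x, g x ≤ N x := by
  have N_zero : N 0 = 0 := by
    have := N_hom 2 two_pos 0
    rw [smul_zero] at this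
    linarith
  have H : ∀ c : ℝ, c • x₀ = 0 → c • N x₀ = 0 := by
    intro c hc
    rcases smul_eq_zero.1 hc with rfl | rfl <;> simp [N_zero]
  have hle : ∀ c : ℝ, c * N x₀ ≤ N (c • x₀) := by
    intro c
    rcases lt_trichotomy c 0 with hc | rfl | hc
    · have h1 := N_add (c • x₀) ((-c) • x₀)
      rw [← add_smul, add_neg_cancel, zero_smul, N_zero, N_hom (-c) (neg_pos.2 hc)] at h1
      linarith
    · simp [N_zero]
    · exact (N_hom c hc x₀).ge
  obtain ⟨g, hg, hgN⟩ := exists_extension_of_le_sublinear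
    (LinearPMap.mkSpanSingleton' (σ := RingHom.id ℝ) x₀ (N x₀) H) N N_hom N_add (by
      rintro ⟨x, hx⟩
      obtain ⟨c, rfl⟩ := Submodule.mem_span_singleton.1 hx
      rw [LinearPMap.mkSpanSingleton'_apply]
      exact hle c)
  refine ⟨g, ?_, hgN⟩
  have hx₀ : x₀ ∈ (LinearPMap.mkSpanSingleton' (σ := RingHom.id ℝ) x₀ (N x₀) H).domain :=
    Submodule.mem_span_singleton_self x₀
  exact (hg ⟨x₀, hx₀⟩).trans (LinearPMap.mkSpanSingleton'_apply_self _ _ _ _)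

/-- The largest monotone extension of a functional on `LipCyl d` to bounded continuous functions. -/
noncomputable def upperExtension {d : ℕ} (E : (PathSpace d → ℝ) → ℝ) (f : PathSpace d →ᵇ ℝ) : ℝ :=
  sInf (E '' {X | X ∈ LipCyl d ∧ ∀ ω, f ω ≤ X ω})

section UpperExtension

variable {d : ℕ} {E : (PathSpace d → ℝ) → ℝ}

lemma upperExtension_nonempty (f : PathSpace d →ᵇ ℝ) :
    (E '' {X | X ∈ LipCyl d ∧ ∀ ω, f ω ≤ X ω}).Nonempty :=
  ⟨_, _, ⟨LipCyl.const_mem ‖f‖, fun ω => (le_abs_self _).trans (f.norm_coe_le_norm ω)⟩, rfl⟩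

lemma upperExtension_bddBelow
    (hmono : ∀ X ∈ LipCyl d, ∀ Y ∈ LipCyl d, (∀ ω, X ω ≤ Y ω) → E X ≤ E Y)
    (f : PathSpace d →ᵇ ℝ) :
    BddBelow (E '' {X | X ∈ LipCyl d ∧ ∀ ω, f ω ≤ X ω}) := by
  refine ⟨E fun _ => -‖f‖, ?_⟩
  rintro _ ⟨X, ⟨hX, hfX⟩, rfl⟩
  exact hmono _ (LipCyl.const_mem _) _ hX fun ω =>
    (neg_le_of_abs_le (f.norm_coe_le_norm ω)).trans (hfX ω)

lemma upperExtension_le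
    (hmono : ∀ X ∈ LipCyl d, ∀ Y ∈ LipCyl d, (∀ ω, X ω ≤ Y ω) → E X ≤ E Y)
    {f : PathSpace d →ᵇ ℝ} {X : PathSpace d → ℝ} (hX : X ∈ LipCyl d) (hfX : ∀ ω, f ω ≤ X ω) :
    upperExtension E f ≤ E X :=
  csInf_le (upperExtension_bddBelow hmono f) ⟨X, ⟨hX, hfX⟩, rfl⟩

lemma upperExtension_eq
    (hmono : ∀ X ∈ LipCyl d, ∀ Y ∈ LipCyl d, (∀ ω, X ω ≤ Y ω) → E X ≤ E Y)
    {f : PathSpace d →ᵇ ℝ} (hf : ⇑f ∈ LipCyl d) : upperExtension E f = E f := by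
  refine (upperExtension_le hmono hf fun _ => le_rfl).antisymm
    (le_csInf (upperExtension_nonempty f) ?_)
  rintro _ ⟨X, ⟨hX, hfX⟩, rfl⟩
  exact hmono _ hf _ hX hfX

lemma upperExtension_add
    (hmono : ∀ X ∈ LipCyl d, ∀ Y ∈ LipCyl d, (∀ ω, X ω ≤ Y ω) → E X ≤ E Y)
    (hsub : ∀ X ∈ LipCyl d, ∀ Y ∈ LipCyl d, E (X + Y) ≤ E X + E Y) (f g : PathSpace d →ᵇ ℝ) :
    upperExtension E (f + g) ≤ upperExtension E f + upperExtension E g := by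
  rw [← sub_le_iff_le_add]
  refine le_csInf (upperExtension_nonempty f) ?_
  rintro _ ⟨X, ⟨hX, hfX⟩, rfl⟩
  rw [sub_le_comm]
  refine le_csInf (upperExtension_nonempty g) ?_
  rintro _ ⟨Y, ⟨hY, hgY⟩, rfl⟩
  have h := upperExtension_le hmono (f := f + g) (LipCyl.add_mem hX hY)
    fun ω => add_le_add (hfX ω) (hgY ω)
  linarith [hsub X hX Y hY]

lemma upperExtension_smul
    (hmono : ∀ X ∈ LipCyl d, ∀ Y ∈ LipCyl d, (∀ ω, X ω ≤ Y ω) → E X ≤ E Y)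
    (hpos : ∀ l : ℝ, 0 ≤ l → ∀ X ∈ LipCyl d, E (l • X) = l * E X)
    (c : ℝ) (hc : 0 < c) (f : PathSpace d →ᵇ ℝ) :
    upperExtension E (c • f) = c * upperExtension E f := by
  have key : ∀ (c : ℝ), 0 < c → ∀ f : PathSpace d →ᵇ ℝ,
      upperExtension E (c • f) ≤ c * upperExtension E f := by
    intro c hc f
    rw [← div_le_iff₀' hc]
    refine le_csInf (upperExtension_nonempty f) ?_
    rintro _ ⟨X, ⟨hX, hfX⟩, rfl⟩
    rw [div_le_iff₀' hc, ← hpos c hc.le X hX]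
    exact upperExtension_le hmono (LipCyl.smul_mem c hX) fun ω =>
      mul_le_mul_of_nonneg_left (hfX ω) hc.le
  refine (key c hc f).antisymm ?_
  have h := key c⁻¹ (inv_pos.2 hc) (c • f)
  rwa [inv_smul_smul₀ hc.ne', le_inv_mul_iff₀ hc] at h

/-- Every `X₀` in `LipCyl d` admits a positive normalized linear functional on bounded continuous
functions that is dominated by `E` on `LipCyl d` and agrees with `E` at `X₀`. -/
lemma exists_positive_linearMap_eq
    (hmono : ∀ X ∈ LipCyl d, ∀ Y ∈ LipCyl d, (∀ ω, X ω ≤ Y ω) → E X ≤ E Y)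
    (hconst : ∀ c : ℝ, E (fun _ => c) = c)
    (hsub : ∀ X ∈ LipCyl d, ∀ Y ∈ LipCyl d, E (X + Y) ≤ E X + E Y)
    (hpos : ∀ l : ℝ, 0 ≤ l → ∀ X ∈ LipCyl d, E (l • X) = l * E X)
    {f₀ : PathSpace d →ᵇ ℝ} (hf₀ : ⇑f₀ ∈ LipCyl d) :
    ∃ L : (PathSpace d →ᵇ ℝ) →ₗ[ℝ] ℝ, (∀ f, (∀ ω, 0 ≤ f ω) → 0 ≤ L f) ∧ L 1 = 1 ∧
      (∀ f : PathSpace d →ᵇ ℝ, ⇑f ∈ LipCyl d → L f ≤ E f) ∧ L f₀ = E f₀ := by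
  have h1 : ∀ ω : PathSpace d, (1 : PathSpace d →ᵇ ℝ) ω = 1 := fun _ => rfl
  obtain ⟨L, hL₀, hL⟩ : ∃ L : (PathSpace d →ᵇ ℝ) →ₗ[ℝ] ℝ, L f₀ = upperExtension E f₀ ∧
      ∀ f, L f ≤ upperExtension E f := by
    apply exists_linearMap_eq_of_sublinear
    · exact upperExtension_smul hmono hpos
    · exact upperExtension_add hmono hsub
  have hneg : ∀ (f : PathSpace d →ᵇ ℝ) (c : ℝ), (∀ ω, c ≤ f ω) → c ≤ L f := by
    intro f c hf
    have h := (hL (-f)).trans (upperExtension_le hmono (LipCyl.const_mem (-c)) (f := -f)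
      fun ω => (BoundedContinuousFunction.neg_apply f).trans_le (neg_le_neg (hf ω)))
    rw [hconst, L.map_neg] at h
    linarith
  have hL1 : L 1 ≤ 1 :=
    (hL 1).trans <| (upperExtension_le hmono (LipCyl.const_mem 1) fun ω => (h1 ω).le).trans_eq
      (hconst 1)
  refine ⟨L, fun f hf => hneg f 0 hf, hL1.antisymm (hneg 1 1 fun ω => (h1 ω).ge), fun f hf => ?_,
    ?_⟩
  · exact (hL f).trans_eq (upperExtension_eq hmono hf)
  · exact hL₀.trans (upperExtension_eq hmono hf₀)

end UpperExtension

section StoneCech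

variable {α : Type*} [TopologicalSpace α]

/-- Restriction to `α` of a continuous function on its Stone–Čech compactification. -/
noncomputable def stoneCechRestrict (g : C(StoneCech α, ℝ)) : α →ᵇ ℝ :=
  (BoundedContinuousFunction.mkOfCompact g).compContinuous
    ⟨stoneCechUnit, continuous_stoneCechUnit⟩

@[simp]
lemma stoneCechRestrict_apply (g : C(StoneCech α, ℝ)) (a : α) :
    stoneCechRestrict g a = g (stoneCechUnit a) := rfl

lemma exists_stoneCechRestrict_eq (f : α →ᵇ ℝ) : ∃ g, stoneCechRestrict g = f := by
  have hf : ∀ a, f a ∈ Icc (-‖f‖) ‖f‖ := fun a => abs_le.1 (f.norm_coe_le_norm a)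
  have hc : Continuous fun a => (⟨f a, hf a⟩ : Icc (-‖f‖) ‖f‖) := f.continuous.subtype_mk _
  refine ⟨⟨fun z => (stoneCechExtend hc z : Icc (-‖f‖) ‖f‖),
    continuous_subtype_val.comp (continuous_stoneCechExtend hc)⟩, ?_⟩
  ext a
  simp [stoneCechExtend_stoneCechUnit]

/-- A positive normalized functional on bounded continuous functions is integration against a
probability measure on the Stone–Čech compactification. -/
lemma exists_stoneCech_measure [MeasurableSpace (StoneCech α)] [BorelSpace (StoneCech α)]
    (L : (α →ᵇ ℝ) →ₗ[ℝ] ℝ) (hL : ∀ f, (∀ a, 0 ≤ f a) → 0 ≤ L f) (hL1 : L 1 = 1) :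
    ∃ ν : Measure (StoneCech α), IsProbabilityMeasure ν ∧
      ∀ g : C(StoneCech α, ℝ), ∫ z, g z ∂ν = L (stoneCechRestrict g) := by
  let Λ : C_c(StoneCech α, ℝ) →ₚ[ℝ] ℝ := PositiveLinearMap.mk₀
    { toFun := fun g => L (stoneCechRestrict (g : C(StoneCech α, ℝ)))
      map_add' := fun g h => (map_add L _ _).symm ▸ rfl
      map_smul' := fun c g => (map_smul L _ _).symm ▸ rfl }
    fun g hg => hL _ fun a => hg (stoneCechUnit a)
  have key : ∀ g : C(StoneCech α, ℝ),
      ∫ z, g z ∂(RealRMK.rieszMeasure Λ) = L (stoneCechRestrict g) := fun g =>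
    RealRMK.integral_rieszMeasure Λ (CompactlySupportedContinuousMap.continuousMapEquiv g)
  refine ⟨RealRMK.rieszMeasure Λ, ?_, key⟩
  have h1 := key 1
  have h2 : stoneCechRestrict (1 : C(StoneCech α, ℝ)) = 1 := rfl
  rw [h2, hL1] at h1
  rw [isProbabilityMeasure_iff_real]
  simpa using h1

end StoneCech

section Coordinates

variable {V : Type*}

/-- The retraction of the one-point compactification sending `∞` to a base point `0`. -/
def OnePoint.toZero [Zero V] (x : OnePoint V) : V := x.elim 0 id

variable [TopologicalSpace V] [Zero V]

lemma OnePoint.continuousAt_toZero {x : OnePoint V} (hx : x ≠ OnePoint.infty) :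
    ContinuousAt (OnePoint.toZero (V := V)) x := by
  induction x with
  | infty => exact absurd rfl hx
  | coe v => exact OnePoint.continuousAt_coe.2 continuousAt_id

lemma OnePoint.measurable_toZero_comp [MeasurableSpace V] [BorelSpace V]
    {Z : Type*} [TopologicalSpace Z] [MeasurableSpace Z] [OpensMeasurableSpace Z]
    [T1Space (OnePoint V)] {c : Z → OnePoint V} (hc : Continuous c) :
    Measurable fun z => (c z).toZero := by
  classical
  let s : Set Z := c ⁻¹' {OnePoint.infty}
  have hs : IsClosed s := isClosed_singleton.preimage hc
  have h := ContinuousOn.measurable_piecewise (s := s) (f := fun _ => (0 : V))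
    (g := fun z => (c z).toZero) continuousOn_const
    (fun z hz => ((OnePoint.continuousAt_toZero hz).comp hc.continuousAt).continuousWithinAt)
    hs.measurableSet
  convert h using 1
  ext z
  by_cases hz : c z = OnePoint.infty
  · simp [s, Set.piecewise, hz, OnePoint.toZero]
  · simp [s, Set.piecewise, hz]

end Coordinates

/-- A cutoff vanishing on the ball of radius `n` and equal to `1` outside the ball of radius
`n + 1`. -/
noncomputable def tailCutoff {V : Type*} [Norm V] (n : ℕ) (x : V) : ℝ := min 1 (max 0 (‖x‖ - n))

section TailCutoff

variable {V : Type*} [NormedAddCommGroup V]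

lemma lipschitzWith_tailCutoff (n : ℕ) : LipschitzWith 1 (tailCutoff (V := V) n) := by
  have h : LipschitzWith 1 fun x : V => ‖x‖ - (n : ℝ) := by
    simpa using (lipschitzWith_one_norm (E := V)).sub (LipschitzWith.const (n : ℝ))
  exact (h.const_max 0).const_min 1

lemma tailCutoff_nonneg (n : ℕ) (x : V) : 0 ≤ tailCutoff n x :=
  le_min zero_le_one (le_max_left _ _)

lemma abs_tailCutoff_le (n : ℕ) (x : V) : |tailCutoff n x| ≤ 1 := by
  rw [abs_of_nonneg (tailCutoff_nonneg n x)]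
  exact min_le_left _ _

lemma antitone_tailCutoff (x : V) : Antitone fun n => tailCutoff n x := by
  intro m n hmn
  have h : (m : ℝ) ≤ n := Nat.cast_le.2 hmn
  exact min_le_min_left 1 (max_le_max_left 0 (sub_le_sub_left h _))

lemma tendsto_tailCutoff (x : V) : Tendsto (fun n => tailCutoff n x) atTop (𝓝 0) := by
  obtain ⟨N, hN⟩ := exists_nat_ge ‖x‖
  refine tendsto_atTop_of_eventually_const (i₀ := N) fun n hn => ?_
  have : ‖x‖ - n ≤ 0 := sub_nonpos.2 (hN.trans (Nat.cast_le.2 hn))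
  simp [tailCutoff, max_eq_left this]

lemma tendsto_tailCutoff_cocompact [ProperSpace V] (n : ℕ) :
    Tendsto (tailCutoff (V := V) n) (cocompact V) (𝓝 1) := by
  refine tendsto_const_nhds.congr' ?_
  filter_upwards [tendsto_norm_cocompact_atTop.eventually_ge_atTop ((n : ℝ) + 1)] with x hx
  refine (min_eq_left ?_).symm
  exact (by linarith : (1 : ℝ) ≤ ‖x‖ - n).trans (le_max_right _ _)

end TailCutoff

section PathSpace

variable {d : ℕ}

/-- The extension of the coordinate `ω ↦ ω t` to the Stone–Čech compactification of path space. -/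
noncomputable def coordExtend (t : ℝ≥0) :
    StoneCech (PathSpace d) → OnePoint (Fin d → ℝ) :=
  stoneCechExtend (g := fun ω : PathSpace d => ((ω t : Fin d → ℝ) : OnePoint (Fin d → ℝ)))
    (OnePoint.continuous_coe.comp (continuous_apply t))

lemma continuous_coordExtend (t : ℝ≥0) : Continuous (coordExtend (d := d) t) :=
  continuous_stoneCechExtend _

@[simp]
lemma coordExtend_unit (t : ℝ≥0) (ω : PathSpace d) :
    coordExtend t (stoneCechUnit ω) = ((ω t : Fin d → ℝ) : OnePoint (Fin d → ℝ)) :=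
  stoneCechExtend_stoneCechUnit _ _

/-- The path read off from a point of the Stone–Čech compactification. -/
noncomputable def pathOf (z : StoneCech (PathSpace d)) : PathSpace d :=
  fun t => (coordExtend t z).toZero

lemma pathOf_unit (ω : PathSpace d) : pathOf (stoneCechUnit ω) = ω := by
  ext1 t
  simp [pathOf, OnePoint.toZero]

lemma measurable_pathOf [MeasurableSpace (StoneCech (PathSpace d))]
    [BorelSpace (StoneCech (PathSpace d))] : Measurable (pathOf (d := d)) :=
  measurable_pi_iff.2 fun t => OnePoint.measurable_toZero_comp (continuous_coordExtend t)

/-- A continuous function extending a cylinder function agrees with it wherever the relevant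
coordinates are finite. -/
lemma eq_comp_pathOf {n : ℕ} (t : Fin n → ℝ≥0) {φ : (Fin n → Fin d → ℝ) → ℝ} (hφ : Continuous φ)
    (g : C(StoneCech (PathSpace d), ℝ))
    (hg : ∀ ω, g (stoneCechUnit ω) = φ fun i => ω (t i)) {z : StoneCech (PathSpace d)}
    (hz : ∀ i, coordExtend (t i) z ≠ OnePoint.infty) :
    g z = φ fun i => pathOf z (t i) := by
  have : (comap stoneCechUnit (𝓝 z)).NeBot :=
    comap_neBot_iff_frequently.2 (mem_closure_iff_frequently.1 (denseRange_stoneCechUnit z))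
  have h1 : Tendsto (fun ω => φ fun i => ω (t i)) (comap stoneCechUnit (𝓝 z)) (𝓝 (g z)) :=
    (g.continuous.continuousAt.tendsto.comp tendsto_comap).congr hg
  have h2 : ContinuousAt (fun z => φ fun i => pathOf z (t i)) z :=
    hφ.continuousAt.comp <| continuousAt_pi.2 fun i =>
      ContinuousAt.comp (OnePoint.continuousAt_toZero (hz i))
        (continuous_coordExtend (t i)).continuousAt
  refine tendsto_nhds_unique h1 ((h2.tendsto.comp tendsto_comap).congr fun ω => ?_)
  simp [pathOf_unit]

/-- Tightness of the one-dimensional marginals forces coordinates to be finite almost surely. -/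
lemma ae_coordExtend_ne_infty [MeasurableSpace (StoneCech (PathSpace d))]
    [BorelSpace (StoneCech (PathSpace d))] {ν : Measure (StoneCech (PathSpace d))}
    [IsFiniteMeasure ν] (t : ℝ≥0)
    {u : ℕ → ℝ} (hu : Tendsto u atTop (𝓝 0))
    (h : ∀ (n : ℕ) (g : C(StoneCech (PathSpace d), ℝ)),
      (∀ ω, g (stoneCechUnit ω) = tailCutoff n (ω t)) → ∫ z, g z ∂ν ≤ u n) :
    ∀ᵐ z ∂ν, coordExtend t z ≠ OnePoint.infty := by
  let s : Set (StoneCech (PathSpace d)) := coordExtend t ⁻¹' {OnePoint.infty}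
  have hs : MeasurableSet s :=
    (isClosed_singleton.preimage (continuous_coordExtend t)).measurableSet
  have hle : ∀ n, ν.real s ≤ u n := by
    intro n
    let Φ : C(OnePoint (Fin d → ℝ), ℝ) := OnePoint.continuousMapMk
      ⟨tailCutoff n, (lipschitzWith_tailCutoff n).continuous⟩ 1 (by
        simpa using tendsto_tailCutoff_cocompact n)
    let g : C(StoneCech (PathSpace d), ℝ) := Φ.comp ⟨coordExtend t, continuous_coordExtend t⟩
    have hΦ : ∀ x, 0 ≤ Φ x := by
      intro x
      induction x with
      | infty => exact zero_le_one
      | coe v => exact tailCutoff_nonneg n v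
    refine le_trans ?_ (h n g fun ω => ?_)
    · rw [← integral_indicator_one hs]
      refine integral_mono ((integrable_const (1 : ℝ)).indicator hs)
        ((BoundedContinuousFunction.mkOfCompact g).integrable ν) ?_
      intro z
      by_cases hz : z ∈ s
      · have : g z = 1 := by
          change Φ (coordExtend t z) = 1
          rw [show coordExtend t z = OnePoint.infty from hz]
          rfl
        simp [hz, this]
      · rw [indicator_of_notMem hz]
        exact hΦ _
    · change Φ (coordExtend t (stoneCechUnit ω)) = _
      rw [coordExtend_unit]
      rfl
  have h0 : ν.real s = 0 :=
    le_antisymm (ge_of_tendsto' hu hle) measureReal_nonneg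
  exact measure_eq_zero_iff_ae_notMem.1 ((measureReal_eq_zero_iff (by finiteness)).1 h0)

/-- A positive normalized functional dominated by `E` on `LipCyl d` is represented on `LipCyl d` by
a probability measure on path space. -/
lemma exists_pathSpace_measure {E : (PathSpace d → ℝ) → ℝ}
    (hcont : ∀ t : ℝ≥0, Tendsto (fun n => E fun ω => tailCutoff n (ω t)) atTop (𝓝 0))
    {L : (PathSpace d →ᵇ ℝ) →ₗ[ℝ] ℝ} (hL : ∀ f, (∀ ω, 0 ≤ f ω) → 0 ≤ L f) (hL1 : L 1 = 1)
    (hLE : ∀ f : PathSpace d →ᵇ ℝ, ⇑f ∈ LipCyl d → L f ≤ E f) :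
    ∃ Q : Measure (PathSpace d), IsProbabilityMeasure Q ∧
      ∀ f : PathSpace d →ᵇ ℝ, ⇑f ∈ LipCyl d → ∫ ω, f ω ∂Q = L f := by
  let _ : MeasurableSpace (StoneCech (PathSpace d)) := borel _
  have : BorelSpace (StoneCech (PathSpace d)) := ⟨rfl⟩
  obtain ⟨ν, hν, hνL⟩ := exists_stoneCech_measure L hL hL1
  have hfin : ∀ t : ℝ≥0, ∀ᵐ z ∂ν, coordExtend t z ≠ OnePoint.infty := by
    refine fun t => ae_coordExtend_ne_infty t (hcont t) fun n g hg => ?_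
    have hg' : ⇑(stoneCechRestrict g) = fun ω : PathSpace d => tailCutoff n (ω t) := funext hg
    rw [hνL, ← hg']
    refine hLE _ ?_
    rw [hg']
    refine ⟨1, fun _ => t, fun x => tailCutoff n (x 0),
      ⟨1 * 1, (lipschitzWith_tailCutoff n).comp (LipschitzWith.eval 0)⟩,
      ⟨1, fun x => abs_tailCutoff_le n _⟩, rfl⟩
  refine ⟨ν.map pathOf, Measure.isProbabilityMeasure_map measurable_pathOf.aemeasurable, ?_⟩
  intro f hf
  rw [integral_map measurable_pathOf.aemeasurable (LipCyl.measurable hf).aestronglyMeasurable]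
  obtain ⟨g, rfl⟩ := exists_stoneCechRestrict_eq f
  rw [← hνL g]
  obtain ⟨n, t, φ, ⟨K, hK⟩, -, hX⟩ := hf
  refine integral_congr_ae ?_
  filter_upwards [ae_all_iff.2 fun i => hfin (t i)] with z hz
  rw [eq_comp_pathOf t hK.continuous g (congrFun hX) hz, hX]

end PathSpace

/-- Representation of a sublinear expectation on `L_ip(Ω̄)` which is continuous under
bounded Lipschitz decreasing-to-zero sequences of cylinder functions: there exists a family
`Ps_e` of probability measures on the cylinder σ-algebra of `Ω̄ = (ℝ^d)^{[0,∞)}` such that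
`Ē[X] = max_{Q ∈ Ps_e} ∫ X dQ` for every `X ∈ L_ip(Ω̄)`, the maximum being attained. -/
theorem stmt_12 (d : ℕ) (E : (PathSpace d → ℝ) → ℝ)
    (hmono : ∀ X ∈ LipCyl d, ∀ Y ∈ LipCyl d, (∀ ω, X ω ≤ Y ω) → E X ≤ E Y)
    (hconst : ∀ c : ℝ, E (fun _ => c) = c)
    (hsub : ∀ X ∈ LipCyl d, ∀ Y ∈ LipCyl d, E (X + Y) ≤ E X + E Y)
    (hpos : ∀ l : ℝ, 0 ≤ l → ∀ X ∈ LipCyl d, E (l • X) = l * E X)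
    (hcont : ∀ (m : ℕ) (t : Fin m → ℝ≥0), StrictMono t →
      ∀ φ : ℕ → (Fin m → Fin d → ℝ) → ℝ,
      (∀ n, (∃ K : ℝ≥0, LipschitzWith K (φ n)) ∧ ∃ M : ℝ, ∀ x, |φ n x| ≤ M) →
      (∀ x, Antitone fun n => φ n x) →
      (∀ x, Tendsto (fun n => φ n x) atTop (𝓝 0)) →
      Tendsto (fun n => E fun ω => φ n fun i => ω (t i)) atTop (𝓝 0)) :
    ∃ Pe : Set (Measure (PathSpace d)),
      (∀ Q ∈ Pe, IsProbabilityMeasure Q) ∧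
      ∀ X ∈ LipCyl d,
        (∀ Q ∈ Pe, ∫ ω, X ω ∂Q ≤ E X) ∧ ∃ Q ∈ Pe, ∫ ω, X ω ∂Q = E X := by
  
  have htail : ∀ t : ℝ≥0, Tendsto (fun n => E fun ω => tailCutoff n (ω t)) atTop (𝓝 0) := fun t =>
    hcont 1 (fun _ => t) (Subsingleton.strictMono _) (fun n x => tailCutoff n (x 0))
      (fun n => ⟨⟨1 * 1, (lipschitzWith_tailCutoff n).comp (LipschitzWith.eval 0)⟩,
        ⟨1, fun x => abs_tailCutoff_le n _⟩⟩)
      (fun x => antitone_tailCutoff (x 0)) (fun x => tendsto_tailCutoff (x 0))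
  refine ⟨{Q | IsProbabilityMeasure Q ∧ ∀ X ∈ LipCyl d, ∫ ω, X ω ∂Q ≤ E X}, fun Q hQ => hQ.1,
    fun X hX => ⟨fun Q hQ => hQ.2 X hX, ?_⟩⟩
  obtain ⟨f₀, rfl⟩ := LipCyl.exists_boundedContinuousFunction hX
  obtain ⟨L, hL, hL1, hLE, hL₀⟩ := exists_positive_linearMap_eq hmono hconst hsub hpos hX
  obtain ⟨Q, hQ, hQL⟩ := exists_pathSpace_measure htail hL hL1 hLE
  refine ⟨Q, ⟨hQ, fun Y hY => ?_⟩, (hQL f₀ hX).trans hL₀⟩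
  obtain ⟨f, rfl⟩ := LipCyl.exists_boundedContinuousFunction hY
  exact (hQL f hY).trans_le (hLE f hY)
end

section
/- Let Ω be a metric space with Borel σ-algebra, 𝒫 a nonempty family of Borel probability measures on Ω, c(A) := sup_{P∈𝒫} P(A) and 𝔼[Y] := sup_{P∈𝒫} ∫ Y dP, and let p > 0. If X : Ω → ℝ is Borel measurable with 𝔼[|X|^p] < ∞ and there exists a sequence (f_k) of bounded continuous functions on Ω with 𝔼[|X − f_k|^p] → 0 as k → ∞ (i.e. X ∈ 𝕃^p_c, the completion of C_b(Ω) in 𝕃^p), then: (1) X has a quasi-continuous version, i.e. there exists a quasi-continuous Y : Ω → ℝ with X = Y quasi-surely; and (2) lim_{n→∞} 𝔼[|X|^p · 1_{{|X| > n}}] = 0. -/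
open MeasureTheory Filter Set
open scoped ENNReal Topology

/-- Markov's inequality for `p`-th powers: a small `p`-th moment bounds the probability of a
large value. -/
lemma measure_le_abs_le_of_lintegral_rpow_le {Ω : Type*} [MeasurableSpace Ω] (P : Measure Ω)
    {p δ : ℝ} (hp : 0 < p) (hδ : 0 < δ) {Z : Ω → ℝ} (hZ : Measurable Z)
    (h : ∫⁻ ω, ENNReal.ofReal (|Z ω| ^ p) ∂P ≤ ENNReal.ofReal (δ ^ p) * ENNReal.ofReal δ) :
    P {ω | δ ≤ |Z ω|} ≤ ENNReal.ofReal δ := by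
  have hm : Measurable fun ω => ENNReal.ofReal (|Z ω| ^ p) :=
    (hZ.abs.pow_const p).ennreal_ofReal
  have h1 := (mul_meas_ge_le_lintegral (μ := P) hm (ENNReal.ofReal (δ ^ p))).trans h
  have h0 : ENNReal.ofReal (δ ^ p) ≠ 0 := by
    simpa using Real.rpow_pos_of_pos hδ p
  rw [ENNReal.mul_le_mul_iff_right h0 ENNReal.ofReal_ne_top] at h1
  refine (measure_mono fun ω hω => ?_).trans h1
  exact ENNReal.ofReal_le_ofReal (Real.rpow_le_rpow hδ.le hω hp.le)

/-- If `2 * |g| ≤ |x|`, then `|x| ^ p` is controlled by `|x - g| ^ p`. -/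
lemma abs_rpow_le_two_rpow_mul_abs_sub_rpow {p x g : ℝ} (hp : 0 < p) (h : 2 * |g| ≤ |x|) :
    |x| ^ p ≤ 2 ^ p * |x - g| ^ p := by
  rw [← Real.mul_rpow (by norm_num) (abs_nonneg _)]
  refine Real.rpow_le_rpow (abs_nonneg _) ?_ hp.le
  linarith [abs_sub_abs_le_abs_sub x g]

/-- The tail moments of an upper-expectation limit of bounded continuous functions vanish. -/
lemma tendsto_iSup_setLIntegral_rpow_zero {Ω : Type*} [TopologicalSpace Ω] [MeasurableSpace Ω]
    (Ps : Set (Measure Ω)) {p : ℝ} (hp : 0 < p) {X : Ω → ℝ} (hX : Measurable X)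
    (f : ℕ → BoundedContinuousFunction Ω ℝ)
    (happrox : Tendsto
      (fun k => ⨆ P ∈ Ps, ∫⁻ ω, ENNReal.ofReal (|X ω - f k ω| ^ p) ∂P)
      atTop (𝓝 0)) :
    Tendsto (fun n : ℕ =>
        ⨆ P ∈ Ps, ∫⁻ ω in {ω | (n : ℝ) < |X ω|}, ENNReal.ofReal (|X ω| ^ p) ∂P)
      atTop (𝓝 0) := by
  have hlim := ENNReal.Tendsto.const_mul (a := ENNReal.ofReal (2 ^ p)) happrox
    (Or.inr ENNReal.ofReal_ne_top)
  rw [mul_zero] at hlim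
  rw [ENNReal.tendsto_nhds_zero]
  intro ε hε
  obtain ⟨k, hk⟩ := ((ENNReal.tendsto_nhds_zero.1 hlim) ε hε).exists
  filter_upwards [eventually_ge_atTop ⌈2 * ‖f k‖⌉₊] with n hn
  refine le_trans (iSup₂_le fun P hP => ?_) hk
  have hS : MeasurableSet {ω | (n : ℝ) < |X ω|} := measurableSet_lt measurable_const hX.abs
  calc ∫⁻ ω in {ω | (n : ℝ) < |X ω|}, ENNReal.ofReal (|X ω| ^ p) ∂P
      ≤ ∫⁻ ω in {ω | (n : ℝ) < |X ω|},
          ENNReal.ofReal (2 ^ p) * ENNReal.ofReal (|X ω - f k ω| ^ p) ∂P := by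
        refine setLIntegral_mono' hS fun ω hω => ?_
        rw [← ENNReal.ofReal_mul (by positivity)]
        refine ENNReal.ofReal_le_ofReal (abs_rpow_le_two_rpow_mul_abs_sub_rpow hp ?_)
        have h1 := (f k).norm_coe_le_norm ω
        rw [Real.norm_eq_abs] at h1
        have h2 := Nat.ceil_le.1 hn
        have h3 : (n : ℝ) < |X ω| := hω
        linarith
    _ ≤ ∫⁻ ω, ENNReal.ofReal (2 ^ p) * ENNReal.ofReal (|X ω - f k ω| ^ p) ∂P :=
        setLIntegral_le_lintegral _ _
    _ = ENNReal.ofReal (2 ^ p) * ∫⁻ ω, ENNReal.ofReal (|X ω - f k ω| ^ p) ∂P :=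
        lintegral_const_mul' _ _ ENNReal.ofReal_ne_top
    _ ≤ _ := by
        gcongr
        exact le_iSup₂ (f := fun (P : Measure Ω) (_ : P ∈ Ps) =>
          ∫⁻ ω, ENNReal.ofReal (|X ω - f k ω| ^ p) ∂P) P hP

/-- A sequence of continuous functions whose increments are geometrically small on `s` from some
index on converges on `s` to a function continuous on `s`. -/
lemma continuousOn_limUnder_of_dist_le_geometric {Ω : Type*} [TopologicalSpace Ω]
    {g : ℕ → Ω → ℝ} (hg : ∀ k, Continuous (g k)) {s : Set Ω} {C r : ℝ} (hr0 : 0 ≤ r) (hr : r < 1)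
    (m : ℕ)
    (h : ∀ ω ∈ s, ∀ k, dist (g (k + m) ω) (g (k + 1 + m) ω) ≤ C * r ^ k) :
    ContinuousOn (fun ω => limUnder atTop fun k => g k ω) s := by
  have hlim : ∀ ω ∈ s, Tendsto (fun k => g (k + m) ω) atTop
      (𝓝 (limUnder atTop fun k => g k ω)) := fun ω hω => by
    obtain ⟨a, ha⟩ := cauchySeq_tendsto_of_complete (cauchySeq_of_le_geometric r C hr (h ω hω))
    have ha' : Tendsto (fun k => g k ω) atTop (𝓝 a) :=
      (tendsto_add_atTop_iff_nat (f := fun k => g k ω) m).1 ha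
    rwa [ha'.limUnder_eq]
  have hdist : ∀ ω ∈ s, ∀ k, dist (g (k + m) ω) (limUnder atTop fun k => g k ω)
      ≤ C * r ^ k / (1 - r) := fun ω hω k =>
    dist_le_of_le_geometric_of_tendsto r C hr (h ω hω) (hlim ω hω) k
  have hzero : Tendsto (fun k : ℕ => C * r ^ k / (1 - r)) atTop (𝓝 0) := by
    simpa using ((tendsto_pow_atTop_nhds_zero_of_lt_one hr0 hr).const_mul C).div_const (1 - r)
  have hunif : TendstoUniformlyOn (fun k => g (k + m))
      (fun ω => limUnder atTop fun k => g k ω) atTop s := by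
    rw [Metric.tendstoUniformlyOn_iff]
    intro ε hε
    filter_upwards [hzero.eventually_lt_const hε] with k hk ω hω
    rw [dist_comm]
    exact (hdist ω hω k).trans_lt hk
  exact hunif.continuousOn (Frequently.of_forall fun k => (hg _).continuousOn)

/-- An upper-expectation limit of bounded continuous functions has a quasi-continuous version. -/
lemma exists_quasiContinuous_version {Ω : Type*} [TopologicalSpace Ω] [MeasurableSpace Ω]
    [OpensMeasurableSpace Ω] (Ps : Set (Measure Ω)) {p : ℝ} (hp : 0 < p) {X : Ω → ℝ}
    (hX : Measurable X) (f : ℕ → BoundedContinuousFunction Ω ℝ)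
    (happrox : Tendsto
      (fun k => ⨆ P ∈ Ps, ∫⁻ ω, ENNReal.ofReal (|X ω - f k ω| ^ p) ∂P)
      atTop (𝓝 0)) :
    ∃ Y : Ω → ℝ,
      (∀ ε : ℝ≥0∞, 0 < ε → ∃ O : Set Ω, IsOpen O ∧ (⨆ P ∈ Ps, P O) < ε ∧
        ContinuousOn Y Oᶜ) ∧
      (⨆ P ∈ Ps, P {ω | X ω ≠ Y ω}) = 0 := by
  have hpos : ∀ k : ℕ, (0 : ℝ) < (1 / 2) ^ k := fun k => by positivity
  have hex : ∀ k : ℕ, ∃ n, ∀ P ∈ Ps,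
      P {ω | (1 / 2 : ℝ) ^ k ≤ |X ω - f n ω|} ≤ ENNReal.ofReal ((1 / 2) ^ k) := fun k => by
    have hε : 0 < ENNReal.ofReal (((1 / 2 : ℝ) ^ k) ^ p) * ENNReal.ofReal ((1 / 2) ^ k) :=
      ENNReal.mul_pos (by simpa using Real.rpow_pos_of_pos (hpos k) p) (by simp)
    obtain ⟨n, hn⟩ := (ENNReal.tendsto_nhds_zero.1 happrox _ hε).exists
    exact ⟨n, fun P hP => measure_le_abs_le_of_lintegral_rpow_le P hp (hpos k)
      (hX.sub (f n).continuous.measurable) ((iSup₂_le_iff.1 hn) P hP)⟩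
  choose N hN using hex
  set g : ℕ → Ω → ℝ := fun k => f (N k)
  have hgc : ∀ k, Continuous (g k) := fun k => (f (N k)).continuous
  have hsum : ∑' k : ℕ, ENNReal.ofReal ((1 / 2 : ℝ) ^ k) ≠ ⊤ :=
    summable_geometric_two.tsum_ofReal_ne_top
  have hsum2 : ∑' k : ℕ, 2 * ENNReal.ofReal ((1 / 2 : ℝ) ^ k) ≠ ⊤ := by
    rw [ENNReal.tsum_mul_left]
    exact ENNReal.mul_ne_top (by simp) hsum
  set U : ℕ → Set Ω := fun k => {ω | 2 * (1 / 2 : ℝ) ^ k < |g k ω - g (k + 1) ω|}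
  have hUo : ∀ k, IsOpen (U k) := fun k =>
    isOpen_lt continuous_const ((hgc k).sub (hgc (k + 1))).abs
  have hUm : ∀ P ∈ Ps, ∀ k, P (U k) ≤ 2 * ENNReal.ofReal ((1 / 2 : ℝ) ^ k) := by
    intro P hP k
    have hhalf : (1 / 2 : ℝ) ^ (k + 1) ≤ (1 / 2) ^ k :=
      pow_le_pow_of_le_one (by norm_num) (by norm_num) k.le_succ
    have hsub : U k ⊆ {ω | (1 / 2 : ℝ) ^ k ≤ |X ω - g k ω|} ∪
        {ω | (1 / 2 : ℝ) ^ (k + 1) ≤ |X ω - g (k + 1) ω|} := by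
      intro ω hω
      by_contra hcon
      simp only [mem_union, mem_ofPred_eq, not_or, not_le] at hcon
      have h1 : 2 * (1 / 2 : ℝ) ^ k < |g k ω - g (k + 1) ω| := hω
      have h2 := abs_sub_le (g k ω) (X ω) (g (k + 1) ω)
      rw [abs_sub_comm (g k ω) (X ω)] at h2
      linarith [hcon.1, hcon.2]
    calc P (U k) ≤ _ := measure_mono hsub
      _ ≤ _ := measure_union_le _ _
      _ ≤ ENNReal.ofReal ((1 / 2 : ℝ) ^ k) + ENNReal.ofReal ((1 / 2 : ℝ) ^ k) :=
        add_le_add (hN k P hP) ((hN (k + 1) P hP).trans (ENNReal.ofReal_le_ofReal hhalf))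
      _ = _ := (two_mul _).symm
  refine ⟨fun ω => limUnder atTop fun k => g k ω, fun ε hε => ?_, ?_⟩
  · obtain ⟨m, hm⟩ :=
      ((ENNReal.tendsto_sum_nat_add _ hsum2).eventually_lt_const hε).exists
    refine ⟨⋃ k, U (k + m), isOpen_iUnion fun k => hUo _, lt_of_le_of_lt ?_ hm, ?_⟩
    · exact iSup₂_le fun P hP =>
        (measure_iUnion_le _).trans (ENNReal.tsum_le_tsum fun k => hUm P hP _)
    · refine continuousOn_limUnder_of_dist_le_geometric hgc (C := 2) (r := 1 / 2)
        (by norm_num) (by norm_num) m fun ω hω k => ?_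
      have h1 : ω ∉ U (k + m) := fun hk => hω (mem_iUnion.2 ⟨k, hk⟩)
      have h2 : |g (k + m) ω - g (k + m + 1) ω| ≤ 2 * (1 / 2 : ℝ) ^ (k + m) := not_lt.1 h1
      have h3 : (1 / 2 : ℝ) ^ (k + m) ≤ (1 / 2) ^ k :=
        pow_le_pow_of_le_one (by norm_num) (by norm_num) (Nat.le_add_right k m)
      rw [Real.dist_eq, Nat.add_right_comm k 1 m]
      linarith
  · simp only [ENNReal.iSup_eq_zero]
    intro P hP
    have hbc := ae_eventually_notMem (μ := P)
      (s := fun k => {ω | (1 / 2 : ℝ) ^ k ≤ |X ω - g k ω|})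
      (ne_top_of_le_ne_top hsum (ENNReal.tsum_le_tsum fun k => hN k P hP))
    have hae : ∀ᵐ ω ∂P, X ω = limUnder atTop fun k => g k ω := by
      filter_upwards [hbc] with ω hω
      refine (Tendsto.limUnder_eq ?_).symm
      rw [tendsto_iff_dist_tendsto_zero]
      refine squeeze_zero' (Eventually.of_forall fun _ => dist_nonneg) ?_
        (tendsto_pow_atTop_nhds_zero_of_lt_one (r := (1 / 2 : ℝ)) (by norm_num) (by norm_num))
      filter_upwards [hω] with k hk
      rw [dist_comm, Real.dist_eq]
      exact (not_le.1 hk).le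
    exact ae_iff.1 hae

/-- If `X ∈ 𝕃^p_c` (i.e. `X` is measurable with finite upper `p`-th moment and is
approximated in the upper-expectation distance `𝔼[|·|^p]` by bounded continuous functions),
then `X` has a quasi-continuous version, and `𝔼[|X|^p 1_{{|X| > n}}] → 0` as `n → ∞`. -/
theorem stmt_13 {Ω : Type*} [MetricSpace Ω] [MeasurableSpace Ω] [BorelSpace Ω]
    (Ps : Set (Measure Ω)) (hPs : Ps.Nonempty)
    (hprob : ∀ P ∈ Ps, IsProbabilityMeasure P)
    (p : ℝ) (hp : 0 < p)
    (X : Ω → ℝ) (hX : Measurable X)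
    (hXfin : (⨆ P ∈ Ps, ∫⁻ ω, ENNReal.ofReal (|X ω| ^ p) ∂P) < ⊤)
    (f : ℕ → BoundedContinuousFunction Ω ℝ)
    (happrox : Tendsto
      (fun k => ⨆ P ∈ Ps, ∫⁻ ω, ENNReal.ofReal (|X ω - f k ω| ^ p) ∂P)
      atTop (𝓝 0)) :
    (∃ Y : Ω → ℝ,
      (∀ ε : ℝ≥0∞, 0 < ε → ∃ O : Set Ω, IsOpen O ∧ (⨆ P ∈ Ps, P O) < ε ∧
        ContinuousOn Y Oᶜ) ∧
      (⨆ P ∈ Ps, P {ω | X ω ≠ Y ω}) = 0) ∧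
    Tendsto (fun n : ℕ =>
        ⨆ P ∈ Ps, ∫⁻ ω in {ω | (n : ℝ) < |X ω|}, ENNReal.ofReal (|X ω| ^ p) ∂P)
      atTop (𝓝 0) := by
  exact ⟨exists_quasiContinuous_version Ps hp hX f happrox,
    tendsto_iSup_setLIntegral_rpow_zero Ps hp hX f happrox⟩
end
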